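/- arXiv:1201.3855 — 4 statements merged into one kernel-verified Lean document; each statement's English description precedes it below -/
import Mathlib

section
/- Let $n\ge 1$, $d\ge 1$, let $f_1,\dots,f_n$ be Schwartz functions on $\mathbb{R}$ and $A_1,\dots,A_n:\mathbb{R}\to\mathbb{C}$ smooth functions with bounded derivatives $A_i'\in L^\infty(\mathbb{R})$. If $f(x)=f_1(x_1)\cdots f_n(x_n)$ and $A(x)=A_1(x_1)\cdots A_n(x_n)$, then for almost every $x\in\mathbb{R}^n$ one has $C_{n,d,A}f(x)=C_{1,d,A_1}f_1(x_1)\cdots C_{1,d,A_n}f_n(x_n)$, all the principal value integrals involved existing. -/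
open MeasureTheory Filter Topology SchwartzMap ENNReal

/-- The composed difference quotient
`(Δ_{t₁}^{(1)}/t₁ ∘ ⋯ ∘ Δ_{tₙ}^{(n)}/tₙ) A (x)`. -/
noncomputable def mixedDiffQuot (n : ℕ) (A : (Fin n → ℝ) → ℂ) (x t : Fin n → ℝ) : ℂ :=
  (∑ S ∈ (Finset.univ : Finset (Fin n)).powerset, (-1 : ℂ) ^ (n - S.card) *
      A (fun i => x i + if i ∈ S then t i else 0)) / ∏ i, (t i : ℂ)

/-- The truncated region `{t : ε < |tᵢ| < ε⁻¹ for all i}`. -/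
def truncSet (n : ℕ) (ε : ℝ) : Set (Fin n → ℝ) :=
  {t | ∀ i, ε < |t i| ∧ |t i| < ε⁻¹}

/-- The one-dimensional truncated region `{t : ε < |t| < ε⁻¹}`. -/
def truncSet1 (ε : ℝ) : Set ℝ := {t | ε < |t| ∧ |t| < ε⁻¹}


lemma measurableSet_truncSet1 (ε : ℝ) : MeasurableSet (truncSet1 ε) := by
  unfold truncSet1
  have h : Measurable (fun t : ℝ => |t|) := continuous_abs.measurable
  exact (measurableSet_lt measurable_const h).inter (measurableSet_lt h measurable_const)

lemma aecover_truncSet1 : AECover (volume : Measure ℝ) (𝓝[>] (0:ℝ)) truncSet1 where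
  measurableSet := measurableSet_truncSet1
  ae_eventually_mem := by
    have h0 : ∀ᵐ t : ℝ ∂volume, t ≠ 0 := by
      simp [ae_iff]
    filter_upwards [h0] with t ht
    have htp : 0 < |t| := abs_pos.mpr ht
    have h1 : ∀ᶠ ε : ℝ in 𝓝[>] 0, ε < |t| :=
      (eventually_lt_nhds htp).filter_mono nhdsWithin_le_nhds
    have h2 : ∀ᶠ ε : ℝ in 𝓝[>] 0, |t| < ε⁻¹ :=
      tendsto_inv_nhdsGT_zero.eventually_gt_atTop _
    filter_upwards [h1, h2] with ε a b using ⟨a, b⟩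

lemma pv_exists (g : ℝ → ℂ) (hg : Measurable g) (G : ℝ → ℝ) (hG : Integrable G)
    (hgG : ∀ t, ‖g t‖ ≤ G t) (C : ℝ) (hC : ∀ t, |t| ≤ 1 → ‖g t - g (-t)‖ ≤ C * |t|) :
    ∃ L : ℂ, Tendsto (fun ε : ℝ => ∫ t in truncSet1 ε, g t / (t : ℂ)) (𝓝[>] 0) (𝓝 L) := by
  have hm : Measurable (fun t : ℝ => g t / (t:ℂ)) := by fun_prop
  have hm' : Measurable (fun t : ℝ => g (-t) / (t:ℂ)) := by fun_prop
  have hGn : Integrable (fun t => G (-t)) := hG.comp_neg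
  have hG0 : ∀ t, 0 ≤ G t := fun t => (norm_nonneg _).trans (hgG t)
  have hint : Integrable (fun t : ℝ => g t / (t:ℂ) - g (-t) / (t:ℂ)) := by
    have hb : Integrable (fun t : ℝ => (Set.Icc (-1:ℝ) 1).indicator (fun _ => |C|) t
        + (G t + G (-t))) := by
      refine Integrable.add ?_ (hG.add hGn)
      rw [integrable_indicator_iff measurableSet_Icc]
      exact integrableOn_const (by simp)
    refine hb.mono' (hm.sub hm').aestronglyMeasurable (Eventually.of_forall fun t => ?_)
    rw [← sub_div, norm_div, Complex.norm_real, Real.norm_eq_abs]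
    by_cases ht : |t| ≤ 1
    · rw [Set.indicator_of_mem (show t ∈ Set.Icc (-1:ℝ) 1 from abs_le.mp ht)]
      have : ‖g t - g (-t)‖ / |t| ≤ |C| := by
        apply div_le_of_le_mul₀ (abs_nonneg _) (abs_nonneg _)
        exact (hC t ht).trans (by gcongr; exact le_abs_self C)
      linarith [hG0 t, hG0 (-t)]
    · rw [Set.indicator_of_notMem (show t ∉ Set.Icc (-1:ℝ) 1 from fun h => ht (abs_le.mpr h))]
      push Not at ht
      calc _ ≤ ‖g t - g (-t)‖ := div_le_self (norm_nonneg _) ht.le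
        _ ≤ ‖g t‖ + ‖g (-t)‖ := norm_sub_le _ _
        _ ≤ _ := by linarith [hgG t, hgG (-t)]
  refine ⟨(1/2) * ∫ t : ℝ, (g t / (t:ℂ) - g (-t) / (t:ℂ)), ?_⟩
  refine ((aecover_truncSet1.integral_tendsto_of_countably_generated hint).const_mul
    (1/2 : ℂ)).congr' ?_
  filter_upwards [self_mem_nhdsWithin] with ε hε
  have hε : 0 < ε := hε
  have key : ∀ (u : ℝ → ℂ) (U : ℝ → ℝ), Measurable u → Integrable U → (∀ t, ‖u t‖ ≤ U t) →
      IntegrableOn (fun t : ℝ => u t / (t:ℂ)) (truncSet1 ε) := by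
    intro u U hu hU hb
    refine Integrable.mono' ((hU.const_mul ε⁻¹).integrableOn)
      (by fun_prop : Measurable (fun t : ℝ => u t / (t:ℂ))).aestronglyMeasurable ?_
    filter_upwards [ae_restrict_mem (measurableSet_truncSet1 ε)] with t ht
    rw [norm_div, Complex.norm_real, Real.norm_eq_abs, div_eq_inv_mul]
    have := ht.1
    gcongr
    exact hb t
  rw [integral_sub (key g G hg hG hgG)
    (key (fun t => g (-t)) _ (by fun_prop) hGn (fun t => hgG (-t)))]
  have hneg : ∫ t in truncSet1 ε, g (-t) / (t:ℂ) = - ∫ t in truncSet1 ε, g t / (t:ℂ) := by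
    rw [← integral_indicator (measurableSet_truncSet1 ε),
      ← integral_indicator (measurableSet_truncSet1 ε), ← integral_neg,
      ← integral_neg_eq_self]
    congr 1
    ext t
    by_cases ht : t ∈ truncSet1 ε
    · have ht' : -t ∈ truncSet1 ε := by simpa [truncSet1] using ht
      simp [ht, ht', div_neg]
    · have ht' : -t ∉ truncSet1 ε := by simpa [truncSet1] using ht
      simp [ht, ht']
  rw [hneg]
  ring

lemma symm_mul {u v : ℝ → ℂ} {B C B' C' : ℝ}
    (hu : ∀ t, |t| ≤ 1 → ‖u t‖ ≤ B) (hu' : ∀ t, |t| ≤ 1 → ‖u t - u (-t)‖ ≤ C * |t|)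
    (hv : ∀ t, |t| ≤ 1 → ‖v t‖ ≤ B') (hv' : ∀ t, |t| ≤ 1 → ‖v t - v (-t)‖ ≤ C' * |t|) :
    ∀ t, |t| ≤ 1 → ‖u t * v t - u (-t) * v (-t)‖ ≤ (B * C' + C * B') * |t| := by
  intro t ht
  have h1 := hv (-t) (by simpa using ht)
  calc ‖u t * v t - u (-t) * v (-t)‖ = ‖u t * (v t - v (-t)) + (u t - u (-t)) * v (-t)‖ := by
        congr 1; ring
    _ ≤ ‖u t‖ * ‖v t - v (-t)‖ + ‖u t - u (-t)‖ * ‖v (-t)‖ := by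
        refine (norm_add_le _ _).trans ?_
        rw [norm_mul, norm_mul]
    _ ≤ B * (C' * |t|) + (C * |t|) * B' := by
        gcongr
        · exact (norm_nonneg _).trans (hu t ht)
        · exact hu t ht
        · exact hv' t ht
        · exact (norm_nonneg _).trans (hu' t ht)
        · exact hu' t ht
    _ = _ := by ring

lemma symm_pow {u : ℝ → ℂ} {B C : ℝ}
    (hu : ∀ t, ‖u t‖ ≤ B) (hu' : ∀ t, |t| ≤ 1 → ‖u t - u (-t)‖ ≤ C * |t|) (d : ℕ) :
    ∃ K, ∀ t, |t| ≤ 1 → ‖u t ^ d - u (-t) ^ d‖ ≤ K * |t| := by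
  induction d with
  | zero => exact ⟨0, by simp⟩
  | succ k ih =>
    obtain ⟨K, hK⟩ := ih
    simp only [pow_succ]
    refine ⟨_, symm_mul (u := fun t => u t ^ k) (v := u) (B := B ^ k) ?_ hK
      (fun t _ => hu t) hu'⟩
    intro t _
    rw [norm_pow]
    gcongr
    exact hu t

/-- A `C^1` function is Lipschitz near a point. -/
lemma symm_lip {u : ℝ → ℂ} (hu : ContDiff ℝ 1 u) (x : ℝ) :
    ∃ K, ∀ t, |t| ≤ 1 → ‖u (x + t) - u (x - t)‖ ≤ K * |t| := by
  have hc : Continuous (deriv u) := hu.continuous_deriv le_rfl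
  obtain ⟨K, hK⟩ := (isCompact_Icc (a := x - 1) (b := x + 1)).exists_bound_of_continuousOn
    hc.continuousOn
  refine ⟨K * 2, fun t ht => ?_⟩
  have ht' := abs_le.mp ht
  have := Convex.norm_image_sub_le_of_norm_deriv_le (f := u) (C := K) (x := x - t) (y := x + t)
    (s := Set.Icc (x - 1) (x + 1))
    (fun y _ => (hu.differentiable one_ne_zero) y) hK (convex_Icc _ _)
    ⟨by linarith, by linarith⟩ ⟨by linarith, by linarith⟩
  refine this.trans (le_of_eq ?_)
  rw [show x + t - (x - t) = 2 * t by ring, Real.norm_eq_abs, abs_mul]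
  norm_num
  ring

lemma symm_quot {A : ℝ → ℂ} (hA : ContDiff ℝ (⊤ : ℕ∞) A) (x : ℝ) :
    ∃ K, ∀ t : ℝ, |t| ≤ 1 →
      ‖(A (x + t) - A x) / (t:ℂ) - (A (x + -t) - A x) / ((-t : ℝ):ℂ)‖ ≤ K * |t| := by
  have hd : Differentiable ℝ A := hA.differentiable (by simp)
  have hA1 : ContDiff ℝ 1 (deriv A) := by
    have h2 : ContDiff ℝ (1 + 1) A := hA.of_le (by
      rw [one_add_one_eq_two]; exact WithTop.coe_le_coe.mpr le_top)
    exact h2.deriv'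
  obtain ⟨K, hK⟩ := symm_lip hA1 x
  refine ⟨|K|, fun t ht => ?_⟩
  have hder : ∀ s : ℝ, HasDerivAt (fun s => A (x + s) + A (x - s))
      (deriv A (x + s) - deriv A (x - s)) s := by
    intro s
    have h1 := (hd (x + s)).hasDerivAt.comp_const_add x s
    have h2 := (hd (x - s)).hasDerivAt.comp_const_sub x s
    have h3 := h1.add h2
    rw [← sub_eq_add_neg] at h3
    exact h3
  have := Convex.norm_image_sub_le_of_norm_hasDerivWithin_le
    (f := fun s => A (x + s) + A (x - s)) (C := |K| * |t|) (x := 0) (y := t)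
    (s := Set.Icc (-|t|) |t|) (fun s _ => (hder s).hasDerivWithinAt)
    (fun s hs => by
      have hs' := abs_le.mpr hs
      refine (hK s (hs'.trans ht)).trans ?_
      gcongr
      exact le_abs_self K) (convex_Icc _ _)
    ⟨by simp, by simp⟩ ⟨neg_abs_le t, le_abs_self t⟩
  have e : (A (x + t) - A x) / (t:ℂ) - (A (x + -t) - A x) / ((-t : ℝ):ℂ)
      = (A (x + t) + A (x - t) - (A (x + 0) + A (x - 0))) / (t:ℂ) := by
    push_cast
    rw [div_neg, sub_neg_eq_add, ← add_div]
    simp only [add_zero, sub_zero, ← sub_eq_add_neg]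
    congr 1
    ring
  rw [e, norm_div, Complex.norm_real, Real.norm_eq_abs]
  apply div_le_of_le_mul₀ (abs_nonneg _) (by positivity)
  simpa using this

lemma pv_one (d : ℕ) (f : 𝓢(ℝ, ℂ)) (A : ℝ → ℂ) (hA : ContDiff ℝ (⊤ : ℕ∞) A)
    (hA' : ∃ M : ℝ, ∀ x : ℝ, ‖deriv A x‖ ≤ M) (x : ℝ) :
    ∃ L : ℂ, Tendsto (fun ε : ℝ => ∫ t in truncSet1 ε,
      f (x + t) * (((A (x + t) - A x) / (t : ℂ)) ^ d) / (t : ℂ)) (𝓝[>] 0) (𝓝 L) := by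
  obtain ⟨M, hM⟩ := hA'
  have hM0 : 0 ≤ M := (norm_nonneg _).trans (hM 0)
  have hAc : Continuous A := hA.continuous
  have hd : Differentiable ℝ A := hA.differentiable (by simp)
  set q : ℝ → ℂ := fun t => (A (x + t) - A x) / (t : ℂ) with hq
  have hqM : ∀ t, ‖q t‖ ≤ M := by
    intro t
    have := Convex.norm_image_sub_le_of_norm_deriv_le (f := A) (C := M) (x := x) (y := x + t)
      (s := Set.univ) (fun y _ => hd y) (fun y _ => hM y) convex_univ trivial trivial
    rw [hq]
    simp only [norm_div, Complex.norm_real, Real.norm_eq_abs]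
    apply div_le_of_le_mul₀ (abs_nonneg _) hM0
    simpa using this
  have hqm : Measurable q := by
    have := hAc.measurable
    fun_prop
  have hfc : Continuous f := f.continuous
  obtain ⟨K1, hK1⟩ := symm_quot hA x
  obtain ⟨K2, hK2⟩ := symm_pow (u := q) hqM hK1 d
  obtain ⟨K3, hK3⟩ := symm_lip (u := f) (f.smooth 1) x
  obtain ⟨B, hB⟩ := (isCompact_Icc (a := x - 1) (b := x + 1)).exists_bound_of_continuousOn
    hfc.continuousOn
  have hpow : ∀ t, ‖q t ^ d‖ ≤ M ^ d := fun t => by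
    rw [norm_pow]; gcongr; exact hqM t
  have hfi : Integrable (fun t => ‖f (x + t)‖) := (f.integrable.comp_add_left x).norm
  refine pv_exists (fun t => f (x + t) * q t ^ d) ?_ (fun t => ‖f (x + t)‖ * M ^ d)
    (hfi.mul_const _) ?_ (B * K2 + K3 * M ^ d) ?_
  · have := hfc.measurable
    fun_prop
  · intro t
    rw [norm_mul]
    gcongr
    exact hpow t
  · refine symm_mul (u := fun t => f (x + t)) (v := fun t => q t ^ d) ?_ ?_
      (fun t _ => hpow t) hK2
    · intro t ht
      have := abs_le.mp ht
      exact hB _ ⟨by linarith, by linarith⟩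
    · intro t ht
      simpa [sub_eq_add_neg] using hK3 t ht

lemma mixedDiffQuot_prod (n : ℕ) (A : Fin n → ℝ → ℂ) (x t : Fin n → ℝ) :
    mixedDiffQuot n (fun y => ∏ i, A i (y i)) x t
      = ∏ i, ((A i (x i + t i) - A i (x i)) / (t i : ℂ)) := by
  unfold mixedDiffQuot
  rw [Finset.prod_div_distrib]
  congr 1
  simp only [sub_eq_add_neg]
  rw [Finset.prod_add]
  refine Finset.sum_congr rfl fun S _ => ?_
  rw [Finset.prod_neg, Finset.card_univ_diff, Fintype.card_fin, mul_left_comm]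
  congr 1
  rw [← Finset.prod_sdiff (Finset.subset_univ S), mul_comm]
  congr 1
  · exact Finset.prod_congr rfl fun i hi => by simp [hi]
  · exact Finset.prod_congr rfl fun i hi => by simp [(Finset.mem_sdiff.mp hi).2]

/-- If `f(x) = f₁(x₁)⋯fₙ(xₙ)` with `fᵢ` Schwartz, and
`A(x) = A₁(x₁)⋯Aₙ(xₙ)` with `Aᵢ` smooth with bounded derivative, then for a.e. `x`
all the principal values exist and
`C_{n,d,A} f(x) = C_{1,d,A₁} f₁(x₁) ⋯ C_{1,d,Aₙ} fₙ(xₙ)`. -/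
theorem stmt4 (n : ℕ) (hn : 1 ≤ n) (d : ℕ) (hd : 1 ≤ d)
    (f : Fin n → 𝓢(ℝ, ℂ)) (A : Fin n → ℝ → ℂ)
    (hA : ∀ i, ContDiff ℝ (⊤ : ℕ∞) (A i)) (hA' : ∀ i, ∃ M : ℝ, ∀ x : ℝ, ‖deriv (A i) x‖ ≤ M) :
    ∀ᵐ x ∂(volume : Measure (Fin n → ℝ)),
      ∃ L : Fin n → ℂ,
        (∀ i, Tendsto (fun ε : ℝ =>
            ∫ t in truncSet1 ε,
              f i (x i + t) * (((A i (x i + t) - A i (x i)) / (t : ℂ)) ^ d) / (t : ℂ))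
          (𝓝[>] 0) (𝓝 (L i))) ∧
        Tendsto (fun ε : ℝ =>
            ∫ t in truncSet n ε,
              (∏ i, f i (x i + t i)) *
                (mixedDiffQuot n (fun y => ∏ i, A i (y i)) x t) ^ d / ∏ i, (t i : ℂ))
          (𝓝[>] 0) (𝓝 (∏ i, L i)) := by
  refine Eventually.of_forall fun x => ?_
  choose L hL using fun i => pv_one d (f i) (A i) (hA i) (hA' i) (x i)
  refine ⟨L, hL, ?_⟩
  refine (tendsto_finset_prod Finset.univ fun i _ => hL i).congr fun ε => ?_
  have hset : truncSet n ε = Set.pi Set.univ (fun _ => truncSet1 ε) := by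
    ext t; simp [truncSet, truncSet1]
  rw [hset, volume_pi, Measure.restrict_pi_pi, ← integral_fintype_prod_eq_prod]
  congr 1
  ext t
  rw [mixedDiffQuot_prod, Finset.prod_div_distrib, Finset.prod_mul_distrib, Finset.prod_pow]
end

section
/- Let $l\ge 1$, let $J\subseteq\mathbb{R}$ be an interval, and let $\phi_J$ be a bump function adapted to $J$. Then $\phi_J$ can be written as $\phi_J=\sum_{k\in\mathbb{N}} 2^{-1000\,l\,k}\,\phi^k_J$, where each $\phi^k_J$ is a bump adapted to $J$ (with adaptation constants independent of $k$) satisfying additionally $\mathrm{supp}(\phi^k_J)\subseteq 2^kJ$, where $2^kJ$ is the interval with the same center as $J$ and length $2^k|J|$. Moreover, if $\int_{\mathbb{R}}\phi_J(x)\,dx=0$, then the $\phi^k_J$ can be chosen so that $\int_{\mathbb{R}}\phi^k_J(x)\,dx=0$ for every $k\in\mathbb{N}$. -/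
open MeasureTheory

/-- `φ` is a bump function adapted to the interval with left endpoint `a` and length `L`,
with adaptation constants `C M` (one for each decay exponent `M`):
`|∂^α φ(x)| ≤ C M * |I|^{-α} * (1 + dist(x, I)/|I|)^{-M}` for all `0 ≤ α ≤ 5`, `M`, `x`. -/
def IsBumpAdapted (C : ℕ → ℝ) (a L : ℝ) (φ : ℝ → ℂ) : Prop :=
  ContDiff ℝ 5 φ ∧ ∀ α : ℕ, α ≤ 5 → ∀ M : ℕ, ∀ x : ℝ,
    ‖iteratedDeriv α φ x‖ * L ^ α *
      (1 + Metric.infDist x (Set.Icc a (a + L)) / L) ^ M ≤ C M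

lemma aux_w_one (a L : ℝ) (hL : 0 < L) (x : ℝ) :
    1 ≤ 1 + Metric.infDist x (Set.Icc a (a + L)) / L := by
  have : 0 ≤ Metric.infDist x (Set.Icc a (a + L)) / L :=
    div_nonneg Metric.infDist_nonneg hL.le
  linarith

lemma aux_w_lower (a L : ℝ) (hL : 0 < L) (x : ℝ) :
    L⁻¹ * |x - (a + L / 2)| + 1 / 2 ≤ 1 + Metric.infDist x (Set.Icc a (a + L)) / L := by
  have h : |x - (a + L / 2)| - L / 2 ≤ Metric.infDist x (Set.Icc a (a + L)) := by
    rw [Metric.le_infDist (Set.nonempty_Icc.2 (by linarith))]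
    intro y hy
    rw [Real.dist_eq]
    have h1 : |x - (a + L / 2)| ≤ |x - y| + |y - (a + L / 2)| := abs_sub_le _ _ _
    have h2 : |y - (a + L / 2)| ≤ L / 2 := by
      rw [abs_le]; constructor <;> linarith [hy.1, hy.2]
    linarith
  have h3 : L⁻¹ * (|x - (a + L / 2)| - L / 2) ≤ L⁻¹ * Metric.infDist x (Set.Icc a (a + L)) :=
    mul_le_mul_of_nonneg_left h (by positivity)
  have h4 : L⁻¹ * L = 1 := inv_mul_cancel₀ hL.ne'
  have h5 : Metric.infDist x (Set.Icc a (a + L)) / L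
      = L⁻¹ * Metric.infDist x (Set.Icc a (a + L)) := by rw [div_eq_mul_inv, mul_comm]
  rw [h5]
  nlinarith

lemma aux_cpt (h : ℝ → ℂ) (hc : ContDiff ℝ 5 h) (hs : HasCompactSupport h) :
    ∃ B : ℝ, 0 ≤ B ∧ ∀ α ≤ 5, ∀ x, ‖iteratedDeriv α h x‖ ≤ B := by
  have key : ∀ α : ℕ, ∃ B : ℝ, 0 ≤ B ∧ (α ≤ 5 → ∀ x, ‖iteratedDeriv α h x‖ ≤ B) := by
    intro α
    by_cases hα : α ≤ 5
    · have h1 : Continuous (iteratedFDeriv ℝ α h) :=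
        hc.continuous_iteratedFDeriv (by exact_mod_cast hα)
      obtain ⟨B, hB⟩ := (hs.iteratedFDeriv (𝕜 := ℝ) α).exists_bound_of_continuous h1
      refine ⟨B, (norm_nonneg _).trans (hB 0), fun _ x => ?_⟩
      rw [← norm_iteratedFDeriv_eq_norm_iteratedDeriv]
      exact hB x
    · exact ⟨0, le_rfl, fun h => absurd h hα⟩
  choose B hB0 hB using key
  refine ⟨∑ i ∈ Finset.range 6, B i, Finset.sum_nonneg fun i _ => hB0 i, fun α hα x => ?_⟩
  exact (hB α hα x).trans
    (Finset.single_le_sum (fun i _ => hB0 i) (Finset.mem_range.2 (by omega)))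

lemma aux_mul (C : ℕ → ℝ) (a L : ℝ) (hL : 0 < L) (φ g : ℝ → ℂ) (hφ : IsBumpAdapted C a L φ)
    (hg : ContDiff ℝ 5 g) (A q : ℝ) (N : ℕ) (hq : 0 ≤ q)
    (hgb : ∀ i ≤ 5, ∀ x, ‖iteratedDeriv i g x‖ * L ^ i * q ≤
      A * (1 + Metric.infDist x (Set.Icc a (a + L)) / L) ^ N)
    (α : ℕ) (hα : α ≤ 5) (M : ℕ) (x : ℝ) :
    ‖iteratedDeriv α (fun y => g y * φ y) x‖ * L ^ α *
      (1 + Metric.infDist x (Set.Icc a (a + L)) / L) ^ M * q ≤ 2 ^ α * (A * C (M + N)) := by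
  have hw := aux_w_one a L hL x
  set w := 1 + Metric.infDist x (Set.Icc a (a + L)) / L with hwd
  have hw0 : 0 < w := by linarith
  have h1 := norm_iteratedFDeriv_mul_le (𝕜 := ℝ) hg hφ.1 x (n := α) (by exact_mod_cast hα)
  simp only [norm_iteratedFDeriv_eq_norm_iteratedDeriv] at h1
  calc _ ≤ (∑ i ∈ Finset.range (α + 1), (α.choose i : ℝ) * ‖iteratedDeriv i g x‖ *
        ‖iteratedDeriv (α - i) φ x‖) * L ^ α * w ^ M * q := by gcongr
    _ = ∑ i ∈ Finset.range (α + 1), (α.choose i : ℝ) * ((‖iteratedDeriv i g x‖ * L ^ i * q) *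
        (‖iteratedDeriv (α - i) φ x‖ * L ^ (α - i) * w ^ M)) := by
      simp only [Finset.sum_mul]
      refine Finset.sum_congr rfl fun i hi => ?_
      have : L ^ α = L ^ i * L ^ (α - i) := by
        rw [← pow_add]; congr 1; have := Finset.mem_range.1 hi; omega
      rw [this]; ring
    _ ≤ ∑ i ∈ Finset.range (α + 1), (α.choose i : ℝ) * (A * C (M + N)) := by
      refine Finset.sum_le_sum fun i hi => ?_
      have hi' := Finset.mem_range.1 hi
      have hA := hgb i (by omega) x
      have hC := hφ.2 (α - i) (by omega) (M + N) x
      rw [← hwd] at hA hC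
      have hA0 : 0 ≤ A := by
        have : 0 ≤ A * w ^ N := le_trans (by positivity) hA
        exact nonneg_of_mul_nonneg_left this (by positivity)
      refine mul_le_mul_of_nonneg_left ?_ (by positivity)
      calc _ ≤ (A * w ^ N) * (‖iteratedDeriv (α - i) φ x‖ * L ^ (α - i) * w ^ M) := by gcongr
        _ = A * (‖iteratedDeriv (α - i) φ x‖ * L ^ (α - i) * w ^ (M + N)) := by
          rw [pow_add]; ring
        _ ≤ _ := by gcongr
    _ = _ := by
      rw [← Finset.sum_mul]
      congr 1
      exact_mod_cast Nat.sum_range_choose α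

lemma aux_integrable_w (a L : ℝ) (hL : 0 < L) :
    Integrable (fun x : ℝ => ((1 + Metric.infDist x (Set.Icc a (a + L)) / L) ^ 2)⁻¹) := by
  have h1 : Integrable (fun x : ℝ => 4 * (1 + (L⁻¹ * (x - (a + L / 2))) ^ 2)⁻¹) := by
    have := (integrable_inv_one_add_sq.comp_mul_left' (g := fun x : ℝ => (1 + x ^ 2)⁻¹)
      (inv_ne_zero hL.ne')).comp_sub_right (a + L / 2)
    exact this.const_mul 4
  refine h1.mono' ?_ (Filter.Eventually.of_forall fun x => ?_)
  · have : Continuous fun x : ℝ => (1 + Metric.infDist x (Set.Icc a (a + L)) / L) ^ 2 := by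
      have := Metric.continuous_infDist_pt (Set.Icc a (a + L))
      fun_prop
    refine (this.inv₀ fun x => ?_).aestronglyMeasurable
    have := aux_w_one a L hL x
    positivity
  · have h2 := aux_w_lower a L hL x
    have h3 := aux_w_one a L hL x
    set w := 1 + Metric.infDist x (Set.Icc a (a + L)) / L
    have h4 : (L⁻¹ * (x - (a + L / 2))) ^ 2 = (L⁻¹ * |x - (a + L / 2)|) ^ 2 := by
      rw [mul_pow, mul_pow, sq_abs]
    have h5 : 0 ≤ L⁻¹ * |x - (a + L / 2)| := by positivity
    rw [Real.norm_of_nonneg (by positivity), h4]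
    set u := L⁻¹ * |x - (a + L / 2)|
    rw [← div_eq_mul_inv, inv_eq_one_div, div_le_div_iff₀ (by positivity) (by positivity)]
    nlinarith

lemma aux_int (a L : ℝ) (hL : 0 < L) (f : ℝ → ℂ) (hf : Continuous f) (D : ℝ)
    (hD : ∀ x, ‖f x‖ * (1 + Metric.infDist x (Set.Icc a (a + L)) / L) ^ 2 ≤ D) :
    Integrable f ∧ ‖∫ x, f x‖ ≤
      D * ∫ x, ((1 + Metric.infDist x (Set.Icc a (a + L)) / L) ^ 2)⁻¹ := by
  have hI := (aux_integrable_w a L hL).const_mul D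
  have hb : ∀ x, ‖f x‖ ≤ D * ((1 + Metric.infDist x (Set.Icc a (a + L)) / L) ^ 2)⁻¹ := by
    intro x
    have := aux_w_one a L hL x
    rw [← div_eq_mul_inv, le_div_iff₀ (by positivity)]
    exact hD x
  refine ⟨hI.mono' hf.aestronglyMeasurable (Filter.Eventually.of_forall hb), ?_⟩
  rw [← integral_const_mul]
  exact norm_integral_le_of_norm_le hI (Filter.Eventually.of_forall hb)

/-- cutoff -/
lemma aux_G : ∃ (G : ℝ → ℂ) (B : ℝ), ContDiff ℝ 5 G ∧ 0 ≤ B ∧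
    (∀ α ≤ 5, ∀ x, ‖iteratedDeriv α G x‖ ≤ B) ∧
    (∀ x, |x| ≤ 1 / 4 → G x = 0) ∧ (∀ x, 1 / 2 ≤ |x| → G x = 1) := by
  let f : ContDiffBump (0 : ℝ) := ⟨1 / 4, 1 / 2, by norm_num, by norm_num⟩
  let F : ℝ → ℂ := fun x => (f x : ℂ)
  have hF : ContDiff ℝ 5 F := Complex.ofRealCLM.contDiff.comp f.contDiff
  have hFs : HasCompactSupport F := f.hasCompactSupport.comp_left (g := Complex.ofReal) rfl
  obtain ⟨B, hB0, hB⟩ := aux_cpt F hF hFs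
  refine ⟨fun x => 1 - F x, 1 + B, contDiff_const.sub hF, by positivity, ?_, ?_, ?_⟩
  · intro α hα x
    have : iteratedDeriv α (fun x => 1 - F x) x
        = iteratedDeriv α (fun _ => (1 : ℂ)) x - iteratedDeriv α F x :=
      iteratedDeriv_sub contDiffAt_const (hF.contDiffAt.of_le (by exact_mod_cast hα))
    rw [this, iteratedDeriv_const]
    refine (norm_sub_le _ _).trans (add_le_add ?_ (hB α hα x))
    split_ifs <;> simp
  · intro x hx
    have : f x = 1 := f.one_of_mem_closedBall (by simpa [f] using hx)
    simp [F, this]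
  · intro x hx
    have : f x = 0 := f.zero_of_le_dist (by simpa [f] using hx)
    simp [F, this]

lemma aux_rho (a L : ℝ) (hL : 0 < L) : ∃ (ρ : ℝ → ℂ) (R : ℝ), ContDiff ℝ 5 ρ ∧ 0 ≤ R ∧
    (∀ α ≤ 5, ∀ M : ℕ, ∀ x, ‖iteratedDeriv α ρ x‖ * L ^ α *
      (1 + Metric.infDist x (Set.Icc a (a + L)) / L) ^ M ≤ R) ∧
    (∀ x, x ∉ Set.Icc a (a + L) → ρ x = 0) ∧ Integrable ρ ∧ ∫ x, ρ x = 1 := by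
  let f : ContDiffBump (a + L / 2 : ℝ) := ⟨L / 4, L / 2, by positivity, by linarith⟩
  let F : ℝ → ℂ := fun x => (f.normed volume x : ℂ)
  have hF : ContDiff ℝ 5 F := Complex.ofRealCLM.contDiff.comp f.contDiff_normed
  have hFs : HasCompactSupport F :=
    f.hasCompactSupport_normed.comp_left (g := Complex.ofReal) rfl
  have hts : tsupport F ⊆ Set.Icc a (a + L) := by
    have h1 : Metric.closedBall (a + L / 2) (L / 2) = Set.Icc a (a + L) := by
      rw [Real.closedBall_eq_Icc]; congr 1 <;> ring
    rw [← h1, ← f.tsupport_normed_eq (μ := volume)]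
    exact closure_mono (Function.support_comp_subset (g := Complex.ofReal) rfl _)
  obtain ⟨B, hB0, hB⟩ := aux_cpt F hF hFs
  refine ⟨F, B * (1 + L) ^ 5, hF, by positivity, ?_, ?_, ?_, ?_⟩
  · intro α hα M x
    by_cases hx : x ∈ Set.Icc a (a + L)
    · rw [Metric.infDist_zero_of_mem hx]
      simp only [zero_div, add_zero, one_pow, mul_one]
      gcongr
      · exact hB α hα x
      · calc L ^ α ≤ (1 + L) ^ α := by gcongr; linarith
          _ ≤ (1 + L) ^ 5 := pow_le_pow_right₀ (by linarith) hα
    · have : iteratedFDeriv ℝ α F x = 0 := by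
        by_contra h
        exact hx (hts (support_iteratedFDeriv_subset α h))
      rw [← norm_iteratedFDeriv_eq_norm_iteratedDeriv, this]
      simp only [norm_zero, zero_mul]
      positivity
  · intro x hx
    exact image_eq_zero_of_notMem_tsupport fun h => hx (hts h)
  · exact f.integrable_normed.ofReal
  · have : ∫ x, F x = ((∫ x, f.normed volume x : ℝ) : ℂ) := integral_ofReal
    rw [this, f.integral_normed]; simp

/-- remainder functions -/
lemma aux_E (a L : ℝ) (hL : 0 < L) (C : ℕ → ℝ) (φ : ℝ → ℂ) (hφ : IsBumpAdapted C a L φ) :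
    ∃ E : ℕ → ℝ → ℂ, (∀ k, ContDiff ℝ 5 (E k)) ∧
      (∀ N M : ℕ, ∃ D : ℝ, ∀ k, ∀ α ≤ 5, ∀ x, ‖iteratedDeriv α (E k) x‖ * L ^ α *
        (1 + Metric.infDist x (Set.Icc a (a + L)) / L) ^ M * (2 ^ k) ^ N ≤ D) ∧
      (∀ j k, j ≤ k → ∀ x, 2 ^ k * L / 2 < |x - (a + L / 2)| → E j x = φ x) ∧
      (∀ k, Integrable (E k)) ∧ (∀ k, ∫ x, E k x = 0) := by
  obtain ⟨G, B, hG, hB0, hB, hGz, hG1⟩ := aux_G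
  obtain ⟨ρ, R, hρ, hR0, hR, hρz, hρi, hρ1⟩ := aux_rho a L hL
  let g : ℕ → ℝ → ℂ := fun k x => G ((2 ^ k * L)⁻¹ * (x - (a + L / 2)))
  have hg : ∀ k, ContDiff ℝ 5 (g k) := fun k =>
    hG.comp (contDiff_const.mul (contDiff_id.sub contDiff_const))
  have hgd : ∀ k, ∀ i ≤ 5, ∀ x, iteratedDeriv i (g k) x =
      ((2 ^ k * L)⁻¹) ^ i • iteratedDeriv i G ((2 ^ k * L)⁻¹ * (x - (a + L / 2))) := by
    intro k i hi x
    have h1 := iteratedDeriv_comp_sub_const i (fun y => G ((2 ^ k * L)⁻¹ * y)) (a + L / 2)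
    rw [iteratedDeriv_comp_const_smul (hG.of_le (by exact_mod_cast hi))] at h1
    exact congrFun h1 x
  have hgb : ∀ N k, ∀ i ≤ 5, ∀ x, ‖iteratedDeriv i (g k) x‖ * L ^ i * (2 ^ k) ^ N ≤
      (B * 4 ^ N) * (1 + Metric.infDist x (Set.Icc a (a + L)) / L) ^ N := by
    intro N k i hi x
    have hw1 := aux_w_one a L hL x
    have hw := aux_w_lower a L hL x
    set w := 1 + Metric.infDist x (Set.Icc a (a + L)) / L
    have h2k : (1 : ℝ) ≤ 2 ^ k := one_le_pow₀ (by norm_num)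
    by_cases hx : |(2 ^ k * L)⁻¹ * (x - (a + L / 2))| < 1 / 4
    · have hev : g k =ᶠ[nhds x] fun _ => (0 : ℂ) := by
        have hcont : Continuous fun y : ℝ => |(2 ^ k * L)⁻¹ * (y - (a + L / 2))| := by fun_prop
        filter_upwards [hcont.continuousAt.eventually_lt continuousAt_const hx] with y hy
        exact hGz _ hy.le
      rw [hev.iteratedDeriv_eq i]
      simp only [iteratedDeriv_fun_const_zero, norm_zero, zero_mul]
      positivity
    · push Not at hx
      rw [abs_mul, abs_of_pos (by positivity : 0 < (2 ^ k * L)⁻¹), mul_inv, mul_assoc] at hx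
      set u := L⁻¹ * |x - (a + L / 2)|
      have h4 : (2 : ℝ) ^ k ≤ 4 * w := by
        rw [inv_mul_eq_div, le_div_iff₀ (by positivity)] at hx
        linarith
      rw [hgd k i hi x, norm_smul, norm_pow, Real.norm_of_nonneg (by positivity)]
      have h5 : ((2 ^ k * L)⁻¹) ^ i * L ^ i ≤ 1 := by
        rw [← mul_pow]
        refine pow_le_one₀ (by positivity) ?_
        rw [mul_inv, mul_assoc, inv_mul_cancel₀ hL.ne', mul_one]
        exact inv_le_one_of_one_le₀ h2k
      calc _ = (((2 ^ k * L)⁻¹) ^ i * L ^ i) *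
            ‖iteratedDeriv i G ((2 ^ k * L)⁻¹ * (x - (a + L / 2)))‖ * (2 ^ k) ^ N := by ring
        _ ≤ 1 * B * (4 * w) ^ N := by
          gcongr
          exact hB i hi _
        _ = _ := by rw [mul_pow]; ring
  have hmul : ∀ N k, ∀ α ≤ 5, ∀ M x, ‖iteratedDeriv α (fun y => g k y * φ y) x‖ * L ^ α *
      (1 + Metric.infDist x (Set.Icc a (a + L)) / L) ^ M * (2 ^ k) ^ N ≤
        2 ^ α * (B * 4 ^ N * C (M + N)) := fun N k α hα M x =>
    aux_mul C a L hL φ (g k) hφ (hg k) (B * 4 ^ N) ((2 ^ k) ^ N) N (by positivity)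
      (hgb N k) α hα M x
  have hC0 : ∀ M, 0 ≤ C M := fun M => by
    refine le_trans ?_ (hφ.2 0 (by norm_num) M 0)
    have := aux_w_one a L hL 0
    positivity
  have hgφ : ∀ k, ContDiff ℝ 5 (fun y => g k y * φ y) := fun k => (hg k).mul hφ.1
  set W := ∫ x, ((1 + Metric.infDist x (Set.Icc a (a + L)) / L) ^ 2)⁻¹
  have hint : ∀ N k, Integrable (fun y => g k y * φ y) ∧
      ‖∫ y, g k y * φ y‖ ≤ (B * 4 ^ N * C (2 + N)) / (2 ^ k) ^ N * W := by
    intro N k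
    refine aux_int a L hL _ (hgφ k).continuous _ fun x => ?_
    have := hmul N k 0 (by norm_num) 2 x
    rw [le_div_iff₀ (by positivity)]
    simpa using this
  let m : ℕ → ℂ := fun k => ∫ y, g k y * φ y
  refine ⟨fun k y => g k y * φ y - m k * ρ y,
    fun k => (hgφ k).sub (contDiff_const.mul hρ), ?_, ?_, ?_, ?_⟩
  · intro N M
    refine ⟨2 ^ 5 * (B * 4 ^ N * C (M + N)) + (B * 4 ^ N * C (2 + N)) * W * R, ?_⟩
    intro k α hα x
    have hα' : (α : WithTop ℕ∞) ≤ 5 := by exact_mod_cast hα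
    have hd : iteratedDeriv α (fun y => g k y * φ y - m k * ρ y) x =
        iteratedDeriv α (fun y => g k y * φ y) x - m k * iteratedDeriv α ρ x := by
      rw [← iteratedDeriv_const_mul (m k) (hρ.contDiffAt.of_le hα')]
      exact iteratedDeriv_sub ((hgφ k).contDiffAt.of_le hα')
        ((contDiff_const.mul hρ).contDiffAt.of_le hα')
    have h1 := hmul N k α hα M x
    have h2 := hR α hα M x
    have h3 := (hint N k).2
    have hw1 := aux_w_one a L hL x
    set w := 1 + Metric.infDist x (Set.Icc a (a + L)) / L
    have h4 : ‖m k‖ * (2 ^ k) ^ N ≤ (B * 4 ^ N * C (2 + N)) * W := by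
      have h5 : (0 : ℝ) < (2 ^ k) ^ N := by positivity
      rw [div_mul_eq_mul_div, le_div_iff₀ h5] at h3
      exact h3
    rw [hd]
    calc _ ≤ (‖iteratedDeriv α (fun y => g k y * φ y) x‖ + ‖m k * iteratedDeriv α ρ x‖) * L ^ α *
          w ^ M * (2 ^ k) ^ N := by
          gcongr
          exact norm_sub_le _ _
      _ = ‖iteratedDeriv α (fun y => g k y * φ y) x‖ * L ^ α * w ^ M * (2 ^ k) ^ N +
          (‖m k‖ * (2 ^ k) ^ N) * (‖iteratedDeriv α ρ x‖ * L ^ α * w ^ M) := by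
          rw [norm_mul]; ring
      _ ≤ 2 ^ α * (B * 4 ^ N * C (M + N)) + ((B * 4 ^ N * C (2 + N)) * W) * R := by
          refine add_le_add h1 (mul_le_mul h4 h2 (by positivity) ?_)
          exact le_trans (by positivity) h4
      _ ≤ _ := by
          have := hC0 (M + N)
          gcongr
          norm_num
  · intro j k hjk x hx
    have hjk' : (2 : ℝ) ^ j ≤ 2 ^ k := pow_le_pow_right₀ (by norm_num) hjk
    have h2j : (1 : ℝ) ≤ 2 ^ j := one_le_pow₀ (by norm_num)
    have hxj : 2 ^ j * L / 2 < |x - (a + L / 2)| := lt_of_le_of_lt (by gcongr) hx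
    have h1 : g j x = 1 := by
      refine hG1 _ ?_
      rw [abs_mul, abs_of_pos (by positivity : 0 < (2 ^ j * L)⁻¹), inv_mul_eq_div,
        le_div_iff₀ (by positivity)]
      linarith
    have h2 : ρ x = 0 := by
      refine hρz x fun h => ?_
      have : |x - (a + L / 2)| ≤ L / 2 := by
        rw [abs_le]; constructor <;> linarith [h.1, h.2]
      nlinarith
    simp [h1, h2]
  · intro k
    exact (hint 0 k).1.sub (hρi.const_mul _)
  · intro k
    rw [integral_sub (hint 0 k).1 (hρi.const_mul _), integral_const_mul, hρ1]
    simp [m]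

/-- Any bump `φ` adapted to an interval `J` (here `J = [a, a+L]`) can be
decomposed as `φ = ∑_{k ∈ ℕ} 2^{-1000 l k} φ^k`, where each `φ^k` is a bump adapted to `J`
with adaptation constants independent of `k`, and `φ^k` is supported in the interval `2^k J`
with the same center as `J` and length `2^k |J|`.  Moreover if `∫ φ = 0` then the `φ^k` can
be chosen with `∫ φ^k = 0` for every `k`. -/
theorem stmt9 (l : ℕ) (hl : 1 ≤ l) (a L : ℝ) (hL : 0 < L) (C : ℕ → ℝ) (φ : ℝ → ℂ)
    (hφ : IsBumpAdapted C a L φ) :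
    ∃ (C' : ℕ → ℝ) (ψ : ℕ → ℝ → ℂ),
      (∀ k : ℕ, IsBumpAdapted C' a L (ψ k)) ∧
      (∀ k : ℕ, Function.support (ψ k) ⊆
        Set.Icc (a + L / 2 - 2 ^ k * L / 2) (a + L / 2 + 2 ^ k * L / 2)) ∧
      (∀ x : ℝ, HasSum (fun k : ℕ => ((2 : ℂ) ^ (1000 * l * k))⁻¹ * ψ k x) (φ x)) ∧
      ((∫ x : ℝ, φ x) = 0 → ∀ k : ℕ, (∫ x : ℝ, ψ k x) = 0) := by
  obtain ⟨E, hE, hEb, hEφ, hEi, hE0⟩ := aux_E a L hL C φ hφ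
  let F : ℕ → ℝ → ℂ := fun k => Nat.casesOn k φ E
  have hF0 : F 0 = φ := rfl
  have hFs : ∀ k, F (k + 1) = E k := fun k => rfl
  have hF : ∀ k, ContDiff ℝ 5 (F k) := fun k => by
    cases k with
    | zero => exact hφ.1
    | succ k => exact hE k
  choose D hD using hEb (1000 * l)
  set P : ℝ := 2 ^ (1000 * l) with hP
  have hP1 : 1 ≤ P := one_le_pow₀ (by norm_num)
  have hpow : ∀ k : ℕ, (2 : ℝ) ^ (1000 * l * k) = (2 ^ k) ^ (1000 * l) := fun k => by
    rw [← pow_mul, mul_comm]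
  have hFb : ∀ M k, ∀ α ≤ 5, ∀ x, ‖iteratedDeriv α (F k) x‖ * L ^ α *
      (1 + Metric.infDist x (Set.Icc a (a + L)) / L) ^ M * 2 ^ (1000 * l * k) ≤
        |C M| + P * |D M| := by
    intro M k α hα x
    cases k with
    | zero =>
      have := hφ.2 α hα M x
      rw [hF0, mul_zero, pow_zero, mul_one]
      have h3 : 0 ≤ P * |D M| := by positivity
      linarith [le_abs_self (C M)]
    | succ k =>
      have := hD M k α hα x
      rw [hFs, mul_add, pow_add, mul_one, ← mul_assoc, hpow]
      have h3 : P * |D M| ≥ P * D M := by gcongr; exact le_abs_self _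
      have h4 := abs_nonneg (C M)
      have h5 := mul_le_mul_of_nonneg_right this (by positivity : 0 ≤ P)
      linarith
  have hFb' : ∀ M k, ∀ α ≤ 5, ∀ x, ‖iteratedDeriv α (F (k + 1)) x‖ * L ^ α *
      (1 + Metric.infDist x (Set.Icc a (a + L)) / L) ^ M * 2 ^ (1000 * l * k) ≤ |D M| := by
    intro M k α hα x
    have := hD M k α hα x
    rw [hFs, hpow]
    exact this.trans (le_abs_self _)
  have hψb : ∀ k, IsBumpAdapted (fun M => |C M| + P * |D M| + |D M|) a L
      (fun x => (2 : ℂ) ^ (1000 * l * k) * (F k x - F (k + 1) x)) := by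
    intro k
    refine ⟨contDiff_const.mul ((hF k).sub (hF (k + 1))), fun α hα M x => ?_⟩
    have hα' : (α : WithTop ℕ∞) ≤ 5 := by exact_mod_cast hα
    have hd : iteratedDeriv α (fun x => (2 : ℂ) ^ (1000 * l * k) * (F k x - F (k + 1) x)) x =
        (2 : ℂ) ^ (1000 * l * k) * (iteratedDeriv α (F k) x - iteratedDeriv α (F (k + 1)) x) := by
      rw [← iteratedDeriv_sub ((hF k).contDiffAt.of_le hα') ((hF (k + 1)).contDiffAt.of_le hα')]
      exact iteratedDeriv_const_mul _ (((hF k).sub (hF (k + 1))).contDiffAt.of_le hα')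
    have h1 := hFb M k α hα x
    have h2 := hFb' M k α hα x
    have hw1 := aux_w_one a L hL x
    set w := 1 + Metric.infDist x (Set.Icc a (a + L)) / L
    rw [hd, norm_mul, norm_pow, Complex.norm_two]
    calc _ ≤ 2 ^ (1000 * l * k) * (‖iteratedDeriv α (F k) x‖ + ‖iteratedDeriv α (F (k + 1)) x‖)
          * L ^ α * w ^ M := by
          gcongr
          exact norm_sub_le _ _
      _ = ‖iteratedDeriv α (F k) x‖ * L ^ α * w ^ M * 2 ^ (1000 * l * k) +
          ‖iteratedDeriv α (F (k + 1)) x‖ * L ^ α * w ^ M * 2 ^ (1000 * l * k) := by ring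
      _ ≤ _ := add_le_add h1 h2
  have hhalf : ∀ k : ℕ, ((2 : ℝ) ^ (1000 * l * k))⁻¹ ≤ (1 / 2) ^ k := fun k => by
    rw [one_div, inv_pow]
    refine inv_anti₀ (by positivity) (pow_le_pow_right₀ (by norm_num) ?_)
    nlinarith
  refine ⟨_, _, hψb, ?_, ?_, ?_⟩
  · intro k x hx
    by_contra hn
    apply hx
    have hlt : 2 ^ k * L / 2 < |x - (a + L / 2)| := by
      by_contra h
      push Not at h
      rw [abs_le] at h
      exact hn ⟨by linarith [h.1], by linarith [h.2]⟩
    have h1 : F (k + 1) x = φ x := hEφ k k le_rfl x hlt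
    have h2 : F k x = φ x := by
      cases k with
      | zero => rfl
      | succ k => exact hEφ k (k + 1) (Nat.le_succ k) x hlt
    simp [h1, h2]
  · intro x
    have hcancel : ∀ k, ((2 : ℂ) ^ (1000 * l * k))⁻¹ *
        ((2 : ℂ) ^ (1000 * l * k) * (F k x - F (k + 1) x)) = F k x - F (k + 1) x := fun k =>
      inv_mul_cancel_left₀ (pow_ne_zero _ two_ne_zero) _
    have hFx : ∀ k, ‖F k x‖ ≤ (|C 0| + P * |D 0|) * (1 / 2) ^ k := by
      intro k
      have h := hFb 0 k 0 (by norm_num) x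
      simp only [iteratedDeriv_zero, pow_zero, mul_one] at h
      rw [← le_div_iff₀ (by positivity), div_eq_mul_inv] at h
      exact h.trans (mul_le_mul_of_nonneg_left (hhalf k) (by positivity))
    have hgeo : Summable fun k : ℕ => (|C 0| + P * |D 0|) * (1 / 2 : ℝ) ^ k :=
      summable_geometric_two.mul_left _
    have hsF : Summable fun k => F k x := Summable.of_norm_bounded hgeo hFx
    have hs : Summable fun k => F k x - F (k + 1) x :=
      hsF.sub ((summable_nat_add_iff 1).2 hsF)
    simp only [hcancel]
    refine (hs.hasSum_iff_tendsto_nat).2 ?_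
    simp only [Finset.sum_range_sub']
    have := (tendsto_const_nhds (x := F 0 x)).sub hsF.tendsto_atTop_zero
    simpa [hF0] using this
  · intro h0 k
    have hφi : Integrable φ := (aux_int a L hL φ hφ.1.continuous (C 2) fun x => by
      simpa using hφ.2 0 (by norm_num) 2 x).1
    have hi : ∀ k, Integrable (F k) := fun k => by
      cases k with
      | zero => exact hφi
      | succ k => exact hEi k
    have hz : ∀ k, ∫ x, F k x = 0 := fun k => by
      cases k with
      | zero => exact h0
      | succ k => exact hE0 k
    rw [integral_const_mul, integral_sub (hi k) (hi (k + 1))]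
    have h1 := hz k
    have h2 := hz (k + 1)
    rw [h1]
    erw [h2]
    simp
end

section
/- Let $n\in\mathbb{Z}$ and $1<p<\infty$. Then for every $N\ge 1$ and all functions $f_1,\dots,f_N\in L^p(\mathbb{R})$ one has the vector-valued Fefferman–Stein inequality $\big\|\big(\sum_{j=1}^N |M_n f_j|^2\big)^{1/2}\big\|_{L^p}\le C_p\,\log^2\langle n\rangle\,\big\|\big(\sum_{j=1}^N |f_j|^2\big)^{1/2}\big\|_{L^p}$, where $C_p$ depends only on $p$ (not on $N$ or $n$). -/
open MeasureTheory ENNReal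

/-- The shifted dyadic maximal operator `M_n f(x) = sup_{I dyadic, x ∈ I} |I_n|⁻¹ ∫_{I_n} |f|`,
where `I_n = I + n|I|`.  Dyadic intervals are `[2^k m, 2^k(m+1))`, `k, m ∈ ℤ`. -/
noncomputable def shiftedMaximal (n : ℤ) (f : ℝ → ℂ) (x : ℝ) : ℝ≥0∞ :=
  ⨆ (k : ℤ) (m : ℤ) (_ : x ∈ Set.Ico ((2:ℝ)^k * m) ((2:ℝ)^k * (m+1))),
    (ENNReal.ofReal ((2:ℝ)^k))⁻¹ *
      ∫⁻ y in Set.Ico ((2:ℝ)^k * (m + n)) ((2:ℝ)^k * (m + n + 1)), (‖f y‖₊ : ℝ≥0∞)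


/-- dyadic interval -/
def DD (k m : ℤ) : Set ℝ := Set.Ico ((2:ℝ)^k * m) ((2:ℝ)^k * (m+1))

/-- inverse length -/
noncomputable def ci (k : ℤ) : ℝ≥0∞ := (ENNReal.ofReal ((2:ℝ)^k))⁻¹

/-- shifted maximal operator on nonnegative functions -/
noncomputable def MM (n : ℤ) (f : ℝ → ℝ≥0∞) (x : ℝ) : ℝ≥0∞ :=
  ⨆ (k : ℤ) (m : ℤ) (_ : x ∈ DD k m), ci k * ∫⁻ y in DD k (m + n), f y

lemma shiftedMaximal_eq (n : ℤ) (f : ℝ → ℂ) :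
    shiftedMaximal n f = MM n (fun y => (‖f y‖₊ : ℝ≥0∞)) := by
  funext x
  simp only [shiftedMaximal, MM, DD, ci]
  push_cast
  rfl

lemma le_MM {n : ℤ} (f : ℝ → ℝ≥0∞) {x : ℝ} {k m : ℤ} (hx : x ∈ DD k m) :
    ci k * ∫⁻ y in DD k (m + n), f y ≤ MM n f x :=
  le_iSup_of_le k (le_iSup_of_le m (le_iSup_of_le hx le_rfl))

lemma MM_le {n : ℤ} {f : ℝ → ℝ≥0∞} {x : ℝ} {b : ℝ≥0∞}
    (h : ∀ k m, x ∈ DD k m → ci k * ∫⁻ y in DD k (m + n), f y ≤ b) : MM n f x ≤ b :=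
  iSup_le fun k => iSup_le fun m => iSup_le fun hx => h k m hx

lemma lt_MM {n : ℤ} {f : ℝ → ℝ≥0∞} {x : ℝ} {b : ℝ≥0∞} (h : b < MM n f x) :
    ∃ k m, x ∈ DD k m ∧ b < ci k * ∫⁻ y in DD k (m + n), f y := by
  simp only [MM, lt_iSup_iff] at h
  obtain ⟨k, m, hx, h⟩ := h
  exact ⟨k, m, hx, h⟩

lemma measurableSet_DD (k m : ℤ) : MeasurableSet (DD k m) := measurableSet_Ico

lemma volume_DD (k m : ℤ) : volume (DD k m) = ENNReal.ofReal ((2:ℝ)^k) := by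
  rw [DD, Real.volume_Ico]; congr 1; ring

lemma two_zpow_pos (k : ℤ) : (0:ℝ) < 2^k := by positivity

lemma ci_mul (k : ℤ) : ci k * ENNReal.ofReal ((2:ℝ)^k) = 1 :=
  ENNReal.inv_mul_cancel (by simpa using two_zpow_pos k) ENNReal.ofReal_ne_top

lemma ci_ne_top (k : ℤ) : ci k ≠ ∞ := by
  rw [ci, ENNReal.inv_ne_top]; simpa using two_zpow_pos k

lemma ci_ne_zero (k : ℤ) : ci k ≠ 0 := by
  rw [ci]; exact ENNReal.inv_ne_zero.2 ENNReal.ofReal_ne_top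

lemma mem_DD {k m : ℤ} {x : ℝ} : x ∈ DD k m ↔ ⌊x / 2^k⌋ = m := by
  rw [Int.floor_eq_iff, DD, Set.mem_Ico, le_div_iff₀ (two_zpow_pos k), div_lt_iff₀ (two_zpow_pos k)]
  constructor <;> rintro ⟨h1, h2⟩ <;> constructor <;> linarith

/-- nesting -/
lemma DD_subset {k m : ℤ} {d : ℕ} : DD k m ⊆ DD (k + d) (m / 2^d) := by
  intro x hx
  rw [mem_DD] at hx ⊢
  rw [zpow_add₀ two_ne_zero, zpow_natCast, ← div_div]
  have := Int.floor_div_natCast (x / 2^k) (2^d)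
  push_cast at this
  rw [this, hx]

lemma DD_nest {k m j m' : ℤ} (h : k ≤ j) {x : ℝ} (hx : x ∈ DD k m) (hx' : x ∈ DD j m') :
    DD k m ⊆ DD j m' := by
  obtain ⟨d, rfl⟩ := Int.le.dest h
  have h1 := DD_subset (d := d) hx
  rw [mem_DD] at h1 hx'
  rw [← hx', h1]
  exact DD_subset

/-- the set of shifts -/
def SS (n : ℤ) : Finset ℤ :=
  (Finset.range (Nat.log 2 n.natAbs + 2)).biUnion fun d => {n / 2^d, n / 2^d + 1}

lemma SS_card (n : ℤ) : (SS n).card ≤ 2 * (Nat.log 2 n.natAbs + 2) := by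
  refine Finset.card_biUnion_le.trans ?_
  refine (Finset.sum_le_card_nsmul _ _ 2 fun d _ => Finset.card_le_two).trans ?_
  simp [mul_comm]

lemma div_stable (n : ℤ) (d : ℕ) (hd : Nat.log 2 n.natAbs + 1 ≤ d) :
    n / 2^d = if 0 ≤ n then 0 else -1 := by
  have h1 : n.natAbs < 2^d :=
    (Nat.lt_pow_succ_log_self (by norm_num) _).trans_le (Nat.pow_le_pow_right (by norm_num) hd)
  have h2 : |n| < 2^d := by rw [Int.abs_eq_natAbs]; exact_mod_cast h1
  rw [abs_lt] at h2
  split_ifs with h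
  · exact Int.ediv_eq_zero_of_lt h h2.2
  · rw [Int.ediv_eq_iff_of_pos (by positivity)]
    constructor <;> linarith

lemma mem_SS (n : ℤ) (d : ℕ) : n / 2^d ∈ SS n ∧ n / 2^d + 1 ∈ SS n := by
  have key : ∃ e, e < Nat.log 2 n.natAbs + 2 ∧ n / 2^d = n / 2^e := by
    by_cases h : d < Nat.log 2 n.natAbs + 2
    · exact ⟨d, h, rfl⟩
    · refine ⟨Nat.log 2 n.natAbs + 1, by omega, ?_⟩
      rw [div_stable n d (by omega), div_stable n _ le_rfl]
  obtain ⟨e, he, h⟩ := key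
  rw [h]
  simp only [SS, Finset.mem_biUnion, Finset.mem_range, Finset.mem_insert, Finset.mem_singleton]
  exact ⟨⟨e, he, Or.inl rfl⟩, ⟨e, he, Or.inr rfl⟩⟩

lemma abs_mem_SS {n s : ℤ} (hs : s ∈ SS n) : s.natAbs ≤ n.natAbs + 1 := by
  simp only [SS, Finset.mem_biUnion, Finset.mem_range, Finset.mem_insert, Finset.mem_singleton] at hs
  obtain ⟨d, -, h⟩ := hs
  have : (n / 2^d).natAbs ≤ n.natAbs := Int.natAbs_ediv_le_natAbs _ _
  omega

/-- covering -/
lemma cover {n k m j m' : ℤ} (h : k ≤ j) {x : ℝ} (hx : x ∈ DD k m) (hs : DD k (m + n) ⊆ DD j m') :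
    ∃ s ∈ SS n, x ∈ DD j (m' - s) := by
  obtain ⟨d, rfl⟩ := Int.le.dest h
  have hy : x + 2^k * n ∈ DD k (m + n) := by
    simp only [DD, Set.mem_Ico] at hx ⊢
    push_cast
    constructor <;> linarith
  have hy2 := hs hy
  have hx2 := DD_subset (d := d) hx
  have hy3 := DD_subset (d := d) hy
  rw [mem_DD] at hy2 hy3
  have e : m' = (m + n) / 2^d := by rw [← hy2, hy3]
  obtain ⟨a, b⟩ := mem_SS n d
  have hp : (0:ℤ) < 2^d := by positivity
  have c1 : m / 2^d + n / 2^d ≤ m' := by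
    rw [e, Int.le_ediv_iff_mul_le hp, add_mul]
    exact add_le_add (Int.ediv_mul_le _ hp.ne') (Int.ediv_mul_le _ hp.ne')
  have c2 : m' < m / 2^d + n / 2^d + 2 := by
    rw [e, Int.ediv_lt_iff_lt_mul hp]
    have := Int.lt_ediv_add_one_mul_self m hp
    have := Int.lt_ediv_add_one_mul_self n hp
    linarith
  rcases (by omega : m' - n / 2^d = m / 2^d ∨ m' - (n / 2^d + 1) = m / 2^d) with q | q
  · exact ⟨_, a, by rw [q]; exact hx2⟩
  · exact ⟨_, b, by rw [q]; exact hx2⟩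

lemma measurable_MM (n : ℤ) (f : ℝ → ℝ≥0∞) : Measurable (MM n f) := by
  unfold MM
  refine Measurable.iSup fun k => Measurable.iSup fun m => ?_
  have : (fun x => ⨆ (_ : x ∈ DD k m), ci k * ∫⁻ y in DD k (m + n), f y) =
      (DD k m).indicator (fun _ => ci k * ∫⁻ y in DD k (m + n), f y) := by
    funext x
    by_cases hx : x ∈ DD k m <;> simp [hx]
  rw [this]
  exact measurable_const.indicator (measurableSet_DD k m)

lemma MM_congr {n : ℤ} {f g : ℝ → ℝ≥0∞} (h : f =ᵐ[volume] g) : MM n f = MM n g := by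
  funext x
  unfold MM
  have e : ∀ k m : ℤ, ∫⁻ y in DD k (m + n), f y = ∫⁻ y in DD k (m + n), g y := fun _ _ =>
    lintegral_congr_ae (ae_restrict_of_ae h)
  simp only [e]

lemma MM_mono {n : ℤ} {f g : ℝ → ℝ≥0∞} (h : f ≤ g) (x : ℝ) : MM n f x ≤ MM n g x :=
  MM_le fun k m hx => (mul_le_mul_right (lintegral_mono h) _).trans (le_MM g hx)

lemma MM_add_const {n : ℤ} (f : ℝ → ℝ≥0∞) (c : ℝ≥0∞) (x : ℝ) :
    MM n (fun y => f y + c) x ≤ MM n f x + c := by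
  refine MM_le fun k m hx => ?_
  rw [lintegral_add_right _ measurable_const, mul_add, setLIntegral_const, volume_DD,
    mul_left_comm, ci_mul, mul_one]
  gcongr
  exact le_MM f hx

lemma MM_one_le (n : ℤ) (x : ℝ) : MM n (fun _ => 1) x ≤ 1 := by
  refine MM_le fun _ _ _ => ?_
  rw [setLIntegral_const, volume_DD, one_mul, ci_mul]

lemma MM_tsum_le {n : ℤ} (f : ℕ → ℝ → ℝ≥0∞) (hf : ∀ i, Measurable (f i)) (x : ℝ) :
    MM n (fun y => ∑' i, f i y) x ≤ ∑' i, MM n (f i) x := by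
  refine MM_le fun k m hx => ?_
  rw [lintegral_tsum (fun i => (hf i).aemeasurable), ← ENNReal.tsum_mul_left]
  exact ENNReal.tsum_le_tsum fun i => le_MM _ hx

lemma MM_const_mul_le {n : ℤ} (f : ℝ → ℝ≥0∞) (hf : Measurable f) (c : ℝ≥0∞) (x : ℝ) :
    MM n (fun y => c * f y) x ≤ c * MM n f x := by
  refine MM_le fun k m hx => ?_
  rw [lintegral_const_mul _ hf, mul_left_comm]
  gcongr
  exact le_MM f hx


/-- selected intervals -/
def Sel (f : ℝ → ℝ≥0∞) (l : ℝ≥0∞) (K : ℤ) (q : ℤ × ℤ) : Prop :=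
  q.1 ≤ K ∧ l < ci q.1 * (∫⁻ y in DD q.1 q.2, f y) ∧
    ∀ j m, q.1 < j → j ≤ K → DD q.1 q.2 ⊆ DD j m → ¬ (l < ci j * ∫⁻ y in DD j m, f y)

lemma exists_Sel {f : ℝ → ℝ≥0∞} {l : ℝ≥0∞} {K : ℤ} (d : ℕ) : ∀ {k m : ℤ}, K - k = d →
    l < ci k * (∫⁻ y in DD k m, f y) → ∃ q, Sel f l K q ∧ k ≤ q.1 ∧ DD k m ⊆ DD q.1 q.2 := by
  induction d using Nat.strong_induction_on with
  | _ d ih =>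
    intro k m hk hl
    by_cases h : ∃ j m', k < j ∧ j ≤ K ∧ DD k m ⊆ DD j m' ∧ l < ci j * ∫⁻ y in DD j m', f y
    · obtain ⟨j, m', h1, h2, h3, h4⟩ := h
      obtain ⟨q, hq, h5, h6⟩ := ih (K - j).toNat (by omega) (by omega) h4
      exact ⟨q, hq, h1.le.trans h5, h3.trans h6⟩
    · refine ⟨(k, m), ⟨by simp; omega, hl, ?_⟩, le_rfl, subset_rfl⟩
      intro j m' h1 h2 h3 h4
      exact h ⟨j, m', h1, h2, h3, h4⟩

lemma Sel_disjoint (f : ℝ → ℝ≥0∞) (l : ℝ≥0∞) (K : ℤ) :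
    Pairwise (Function.onFun Disjoint (fun q : {q // Sel f l K q} => DD q.1.1 q.1.2)) := by
  have key : ∀ q q' : {q // Sel f l K q}, q.1.1 ≤ q'.1.1 → ∀ x, x ∈ DD q.1.1 q.1.2 →
      x ∈ DD q'.1.1 q'.1.2 → q = q' := by
    rintro ⟨⟨j, m⟩, h⟩ ⟨⟨j', m'⟩, h'⟩ hjj x hx hx'
    simp only at hjj hx hx'
    have hn := DD_nest hjj hx hx'
    rcases hjj.lt_or_eq with h1 | h1
    · exact absurd h'.2.1 (h.2.2 j' m' h1 h'.1 hn)
    · subst h1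
      rw [mem_DD] at hx hx'
      simp [← hx, ← hx']
  intro q q' hne
  rw [Function.onFun, Set.disjoint_left]
  intro x hx hx'
  rcases le_total q.1.1 q'.1.1 with h | h
  · exact hne (key q q' h x hx hx')
  · exact hne (key q' q h x hx' hx).symm

lemma weak_trunc (n : ℤ) (f w : ℝ → ℝ≥0∞) (l : ℝ≥0∞) (K : ℤ) :
    l * ∫⁻ x in {x | ∃ k ≤ K, ∃ m, x ∈ DD k m ∧ l < ci k * ∫⁻ y in DD k (m + n), f y}, w x ≤
      ∑ s ∈ SS n, ∫⁻ y, f y * MM (-s) w y := by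
  have hsub : {x | ∃ k ≤ K, ∃ m, x ∈ DD k m ∧ l < ci k * ∫⁻ y in DD k (m + n), f y} ⊆
      ⋃ (r : SS n × {q // Sel f l K q}), DD r.2.1.1 (r.2.1.2 - r.1.1) := by
    rintro x ⟨k, hk, m, hx, h⟩
    obtain ⟨q, hq, h1, h2⟩ := exists_Sel (K := K) (K - k).toNat (by omega) h
    obtain ⟨s, hs, h3⟩ := cover h1 hx h2
    exact Set.mem_iUnion.2 ⟨⟨⟨s, hs⟩, ⟨q, hq⟩⟩, h3⟩
  calc _ ≤ l * ∑' (r : SS n × {q // Sel f l K q}), ∫⁻ x in DD r.2.1.1 (r.2.1.2 - r.1.1), w x := by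
        gcongr
        exact (lintegral_mono_set hsub).trans (lintegral_iUnion_le _ _)
    _ = ∑' (s : SS n), ∑' (q : {q // Sel f l K q}), l * ∫⁻ x in DD q.1.1 (q.1.2 - s.1), w x := by
        rw [ENNReal.tsum_prod (f := fun (s : SS n) (q : {q // Sel f l K q}) =>
          ∫⁻ x in DD q.1.1 (q.1.2 - s.1), w x), ← ENNReal.tsum_mul_left]
        simp_rw [ENNReal.tsum_mul_left]
    _ ≤ ∑' (s : SS n), ∑' (q : {q // Sel f l K q}), ∫⁻ y in DD q.1.1 q.1.2, f y * MM (-s) w y := by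
        refine ENNReal.tsum_le_tsum fun s => ENNReal.tsum_le_tsum fun q => ?_
        obtain ⟨⟨j, m⟩, hq⟩ := q
        have h1 := hq.2.1
        simp only at h1 ⊢
        calc l * ∫⁻ x in DD j (m - s), w x
            ≤ (ci j * ∫⁻ y in DD j m, f y) * ∫⁻ x in DD j (m - s), w x := by gcongr
          _ = (ci j * ∫⁻ x in DD j (m - s), w x) * ∫⁻ y in DD j m, f y := by ring
          _ ≤ ∫⁻ y in DD j m, (ci j * ∫⁻ x in DD j (m - s), w x) * f y :=
              lintegral_const_mul_le _ _
          _ ≤ _ := by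
              refine setLIntegral_mono' (measurableSet_DD j m) fun y hy => ?_
              rw [mul_comm]
              gcongr
              exact le_MM w hy
    _ ≤ ∑' (s : SS n), ∫⁻ y, f y * MM (-s) w y := by
        refine ENNReal.tsum_le_tsum fun s => ?_
        rw [← lintegral_iUnion (fun q => measurableSet_DD _ _) (Sel_disjoint f l K)]
        exact setLIntegral_le_lintegral _ _
    _ = _ := by
        rw [tsum_fintype]
        exact Finset.sum_coe_sort (SS n) (fun s => ∫⁻ y, f y * MM (-s) w y)

lemma weak (n : ℤ) (f w : ℝ → ℝ≥0∞) (l : ℝ≥0∞) :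
    l * ∫⁻ x in {x | l < MM n f x}, w x ≤ ∑ s ∈ SS n, ∫⁻ y, f y * MM (-s) w y := by
  set U : ℕ → Set ℝ := fun K =>
    {x | ∃ k ≤ (K:ℤ), ∃ m, x ∈ DD k m ∧ l < ci k * ∫⁻ y in DD k (m + n), f y} with hU
  have hsub : {x | l < MM n f x} ⊆ ⋃ K, U K := by
    intro x hx
    obtain ⟨k, m, h1, h2⟩ := lt_MM hx
    exact Set.mem_iUnion.2 ⟨k.toNat, k, by omega, m, h1, h2⟩
  have hmono : Monotone U := by
    rintro a b hab x ⟨k, hk, h⟩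
    exact ⟨k, hk.trans (by exact_mod_cast hab), h⟩
  calc _ ≤ l * ∫⁻ x in ⋃ K, U K, w x := by gcongr
    _ = ⨆ K, l * ∫⁻ x in U K, w x := by
        rw [setLIntegral_iUnion_of_directed _ hmono.directed_le, ENNReal.mul_iSup]
    _ ≤ _ := iSup_le fun K => weak_trunc n f w l K


/-- powers of two -/
noncomputable def TT (i : ℤ) : ℝ≥0∞ := (2:ℝ≥0∞) ^ (i : ℝ)

lemma TT_zpow (i : ℤ) : TT i = (2:ℝ≥0∞) ^ i := ENNReal.rpow_intCast _ _

lemma TT_pos (i : ℤ) : 0 < TT i := ENNReal.rpow_pos (by norm_num) (by norm_num)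

lemma TT_ne_top (i : ℤ) : TT i ≠ ∞ := by
  exact ENNReal.rpow_ne_top_of_ne_zero (by norm_num) (by norm_num)

lemma TT_lt {i j : ℤ} : TT i < TT j ↔ i < j := by
  unfold TT
  constructor
  · intro h
    by_contra hc
    exact absurd h (not_lt.2 (ENNReal.rpow_le_rpow_of_exponent_le (by norm_num)
      (by exact_mod_cast not_lt.1 hc)))
  · intro h
    exact ENNReal.rpow_lt_rpow_of_exponent_lt (by norm_num) (by norm_num) (by exact_mod_cast h)

lemma TT_pred (i : ℤ) : TT (i - 1) + TT (i - 1) = TT i := by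
  unfold TT
  rw [← two_mul]
  nth_rw 1 [← ENNReal.rpow_one 2]
  rw [← ENNReal.rpow_add _ _ (by norm_num) (by norm_num)]
  congr 1; push_cast; ring

lemma exists_TT {u : ℝ≥0∞} (h0 : u ≠ 0) (ht : u ≠ ∞) : ∃ i, TT i < u ∧ u ≤ TT (i + 1) := by
  obtain ⟨i, hi⟩ := ENNReal.exists_mem_Ioc_zpow h0 ht (y := 2) (by norm_num) (by norm_num)
  exact ⟨i, by rw [TT_zpow]; exact hi.1, by rw [TT_zpow]; exact hi.2⟩

lemma layer {q : ℝ} (hq : 0 < q) (u : ℝ≥0∞) :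
    u ^ q ≤ ∑' i : ℤ, TT (i + 1) ^ q * (if TT i < u then 1 else 0) := by
  rcases eq_or_ne u 0 with rfl | h0
  · simp [ENNReal.zero_rpow_of_pos hq]
  rcases eq_or_ne u ∞ with rfl | ht
  · refine (le_top.trans
      (ENNReal.tsum_const_eq_top_of_ne_zero (α := ℕ) (c := 1) one_ne_zero).ge).trans ?_
    refine le_trans ?_ (ENNReal.tsum_comp_le_tsum_of_injective (f := fun d : ℕ => (d : ℤ))
      Nat.cast_injective _)
    refine ENNReal.tsum_le_tsum fun d => ?_
    rw [if_pos (TT_ne_top _).lt_top, mul_one]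
    refine ENNReal.one_le_rpow ?_ hq
    rw [TT]
    exact ENNReal.one_le_rpow (by norm_num) (by push_cast; positivity)
  obtain ⟨i, h1, h2⟩ := exists_TT h0 ht
  refine le_trans ?_ (ENNReal.le_tsum i)
  simp only [h1, if_true, mul_one]
  gcongr

/-- constant -/
noncomputable def CC (q : ℝ) : ℝ≥0∞ := 2 ^ (2 * q) * (1 - (2:ℝ≥0∞) ^ (-(q - 1)))⁻¹

lemma CC_ne_top {q : ℝ} (hq : 1 < q) : CC q ≠ ∞ := by
  refine ENNReal.mul_ne_top (by simp) ?_
  rw [ENNReal.inv_ne_top]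
  have : (2:ℝ≥0∞) ^ (-(q - 1)) < 1 :=
    ENNReal.rpow_lt_one_of_one_lt_of_neg (by norm_num) (by linarith)
  exact (tsub_pos_of_lt this).ne'

lemma one_le_CC {q : ℝ} (hq : 1 < q) : 1 ≤ CC q := by
  unfold CC
  refine one_le_mul (ENNReal.one_le_rpow (by norm_num) (by linarith)) ?_
  rw [ENNReal.one_le_inv]
  exact tsub_le_self

lemma geom {q : ℝ} (hq : 1 < q) (t : ℝ≥0∞) :
    ∑' i : ℤ, TT (i + 1) ^ q * (TT (i - 1))⁻¹ * (if TT (i - 1) < t then t else 0) ≤ CC q * t ^ q := by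
  rcases eq_or_ne t 0 with rfl | h0
  · simp
  rcases eq_or_ne t ∞ with rfl | ht
  · rw [ENNReal.top_rpow_of_pos (by linarith), ENNReal.mul_top]
    · exact le_top
    · exact (zero_lt_one.trans_le (one_le_CC hq)).ne'
  obtain ⟨e, h1, h2⟩ := exists_TT h0 ht
  have hinj : Function.Injective (fun d : ℕ => e + 1 - (d:ℤ)) := by
    intro a b h
    simp only at h
    omega
  rw [← hinj.tsum_eq]
  · have hterm : ∀ d : ℕ, TT (e + 1 - (d:ℤ) + 1) ^ q * (TT (e + 1 - (d:ℤ) - 1))⁻¹ *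
        (if TT (e + 1 - (d:ℤ) - 1) < t then t else 0) ≤
        (2 ^ (2 * q) * t ^ q) * ((2:ℝ≥0∞) ^ (-(q - 1))) ^ d := by
      intro d
      have e1 : TT (e + 1 - (d:ℤ) + 1) ^ q * (TT (e + 1 - (d:ℤ) - 1))⁻¹ =
          2 ^ (2 * q) * (TT e) ^ (q - 1) * ((2:ℝ≥0∞) ^ (-(q - 1))) ^ d := by
        unfold TT
        rw [← ENNReal.rpow_neg, ← ENNReal.rpow_natCast, ← ENNReal.rpow_mul, ← ENNReal.rpow_mul,
          ← ENNReal.rpow_mul, ← ENNReal.rpow_add _ _ (by norm_num) (by norm_num),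
          ← ENNReal.rpow_add _ _ (by norm_num) (by norm_num),
          ← ENNReal.rpow_add _ _ (by norm_num) (by norm_num)]
        congr 1; push_cast; ring
      have e2 : t ^ q = t ^ (q - 1) * t := by
        nth_rw 3 [← ENNReal.rpow_one t]
        rw [← ENNReal.rpow_add _ _ h0 ht]; congr 1; ring
      calc _ ≤ 2 ^ (2 * q) * (TT e) ^ (q - 1) * ((2:ℝ≥0∞) ^ (-(q - 1))) ^ d * t := by
            rw [e1]; gcongr; split_ifs <;> simp
        _ ≤ 2 ^ (2 * q) * t ^ (q - 1) * ((2:ℝ≥0∞) ^ (-(q - 1))) ^ d * t := by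
            gcongr
        _ = _ := by rw [e2]; ring
    refine (ENNReal.tsum_le_tsum hterm).trans ?_
    rw [ENNReal.tsum_mul_left, ENNReal.tsum_geometric, CC]
    exact le_of_eq (by ring)
  · intro i hi
    have : TT (i - 1) < t := by
      by_contra hc
      simp [hc] at hi
    have := TT_lt.1 (this.trans_le h2)
    exact ⟨(e + 1 - i).toNat, by simp only; omega⟩

lemma strong {q : ℝ} (hq : 1 < q) (n : ℤ) {f w : ℝ → ℝ≥0∞} (hf : Measurable f)
    (hw : Measurable w) :
    ∫⁻ x, MM n f x ^ q * w x ≤ CC q * ∑ s ∈ SS n, ∫⁻ y, f y ^ q * MM (-s) w y := by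
  have hms : ∀ i, MeasurableSet {x | TT i < MM n f x} := fun i =>
    measurableSet_lt measurable_const (measurable_MM n f)
  have hmf : ∀ i, MeasurableSet {x | TT i < f x} := fun i =>
    measurableSet_lt measurable_const hf
  have hfi : ∀ i, Measurable (fun y => if TT (i - 1) < f y then f y else 0) := fun i =>
    Measurable.ite (hmf _) hf measurable_const
  calc ∫⁻ x, MM n f x ^ q * w x
      ≤ ∫⁻ x, ∑' i : ℤ, TT (i + 1) ^ q * ({x | TT i < MM n f x}.indicator w x) := by
        refine lintegral_mono fun x => ?_
        refine (mul_le_mul_left (layer (by linarith) _) _).trans ?_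
        rw [← ENNReal.tsum_mul_right]
        refine ENNReal.tsum_le_tsum fun i => ?_
        rw [mul_assoc]
        gcongr
        by_cases h : TT i < MM n f x <;> simp [h]
    _ = ∑' i : ℤ, TT (i + 1) ^ q * ∫⁻ x in {x | TT i < MM n f x}, w x := by
        rw [lintegral_tsum]
        · congr 1; funext i
          rw [lintegral_const_mul _ (hw.indicator (hms i)), lintegral_indicator (hms i)]
        · intro i
          exact ((hw.indicator (hms i)).const_mul _).aemeasurable
    _ ≤ ∑' i : ℤ, ∑ s ∈ SS n, ∫⁻ y, (TT (i + 1) ^ q * (TT (i - 1))⁻¹ *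
          (if TT (i - 1) < f y then f y else 0)) * MM (-s) w y := by
        refine ENNReal.tsum_le_tsum fun i => ?_
        have hsub : {x | TT i < MM n f x} ⊆
            {x | TT (i - 1) < MM n (fun y => if TT (i - 1) < f y then f y else 0) x} := by
          intro x hx
          by_contra hc
          simp only [Set.mem_ofPred_eq, not_lt] at hc hx
          have h1 : MM n f x ≤ MM n (fun y => (if TT (i - 1) < f y then f y else 0) + TT (i - 1)) x := by
            refine MM_mono (fun y => ?_) x
            simp only
            split_ifs with h
            · exact le_self_add
            · simpa using h
          have h2 := h1.trans (MM_add_const _ _ x)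
          have h3 := h2.trans (add_le_add_left hc _)
          rw [TT_pred] at h3
          exact absurd hx (not_lt.2 h3)
        have hwk := weak n (fun y => if TT (i - 1) < f y then f y else 0) w (TT (i - 1))
        calc _ ≤ TT (i + 1) ^ q * ∫⁻ x in
                {x | TT (i - 1) < MM n (fun y => if TT (i - 1) < f y then f y else 0) x}, w x := by
              gcongr
          _ = TT (i + 1) ^ q * (TT (i - 1))⁻¹ * (TT (i - 1) * ∫⁻ x in
                {x | TT (i - 1) < MM n (fun y => if TT (i - 1) < f y then f y else 0) x}, w x) := by
              rw [mul_assoc, ← mul_assoc (TT (i - 1))⁻¹,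
                ENNReal.inv_mul_cancel (TT_pos _).ne' (TT_ne_top _), one_mul]
          _ ≤ TT (i + 1) ^ q * (TT (i - 1))⁻¹ *
              (∑ s ∈ SS n, ∫⁻ y, (if TT (i - 1) < f y then f y else 0) * MM (-s) w y) := by gcongr
          _ = _ := by
              rw [Finset.mul_sum]
              refine Finset.sum_congr rfl fun s _ => ?_
              have hm : Measurable (fun y => (if TT (i - 1) < f y then f y else 0) * MM (-s) w y) :=
                (hfi i).mul (measurable_MM _ _)
              rw [← lintegral_const_mul _ hm]
              simp_rw [mul_assoc]
    _ = ∑ s ∈ SS n, ∫⁻ y, ∑' i : ℤ, (TT (i + 1) ^ q * (TT (i - 1))⁻¹ *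
          (if TT (i - 1) < f y then f y else 0)) * MM (-s) w y := by
        rw [Summable.tsum_finsetSum (fun _ _ => ENNReal.summable)]
        refine Finset.sum_congr rfl fun s _ => ?_
        rw [lintegral_tsum]
        intro i
        exact (((hfi i).const_mul _).mul (measurable_MM _ _)).aemeasurable
    _ ≤ ∑ s ∈ SS n, ∫⁻ y, CC q * (f y ^ q * MM (-s) w y) := by
        refine Finset.sum_le_sum fun s _ => lintegral_mono fun y => ?_
        simp only
        rw [ENNReal.tsum_mul_right, ← mul_assoc]
        gcongr
        exact geom hq (f y)
    _ = _ := by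
        rw [Finset.mul_sum]
        refine Finset.sum_congr rfl fun s _ => ?_
        have hm : Measurable (fun y => f y ^ q * MM (-s) w y) :=
          (hf.pow_const q).mul (measurable_MM _ _)
        rw [lintegral_const_mul _ hm]

lemma scalar {q : ℝ} (hq : 1 < q) (n : ℤ) {f : ℝ → ℝ≥0∞} (hf : Measurable f) :
    ∫⁻ x, MM n f x ^ q ≤ CC q * (SS n).card * ∫⁻ y, f y ^ q := by
  have h := strong hq n hf (w := fun _ => 1) measurable_const
  simp only [mul_one] at h
  refine h.trans ?_
  rw [mul_assoc]
  gcongr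
  rw [← nsmul_eq_mul]
  refine Finset.sum_le_card_nsmul _ _ _ fun s _ => lintegral_mono fun y => ?_
  exact mul_le_of_le_one_right' (MM_one_le _ _)


lemma MM_holder {n : ℤ} {f u v : ℝ → ℝ≥0∞} (hu : Measurable u) (hv : Measurable v) {a b : ℝ}
    (ha : 0 ≤ a) (hb : 0 ≤ b) (hab : a + b = 1)
    (h : ∀ᵐ x ∂volume, f x = u x ^ a * v x ^ b) (x : ℝ) :
    MM n f x ≤ MM n u x ^ a * MM n v x ^ b := by
  refine MM_le fun k m hx => ?_
  calc ci k * ∫⁻ y in DD k (m + n), f y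
      = ci k * ∫⁻ y in DD k (m + n), u y ^ a * v y ^ b := by
        rw [lintegral_congr_ae (ae_restrict_of_ae h)]
    _ ≤ ci k * ((∫⁻ y in DD k (m + n), u y) ^ a * (∫⁻ y in DD k (m + n), v y) ^ b) := by
        gcongr
        exact ENNReal.lintegral_mul_norm_pow_le hu.aemeasurable hv.aemeasurable ha hb hab
    _ = (ci k * ∫⁻ y in DD k (m + n), u y) ^ a * (ci k * ∫⁻ y in DD k (m + n), v y) ^ b := by
        rw [ENNReal.mul_rpow_of_nonneg _ _ ha, ENNReal.mul_rpow_of_nonneg _ _ hb]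
        have : ci k = ci k ^ a * ci k ^ b := by
          rw [← ENNReal.rpow_add_of_nonneg _ _ ha hb, hab, ENNReal.rpow_one]
        nth_rw 1 [this]
        ring
    _ ≤ _ := by
        gcongr
        · exact le_MM u hx
        · exact le_MM v hx

lemma caseGT {p : ℝ} (hp : 2 < p) (n : ℤ) {N : ℕ} (F : Fin N → ℝ → ℝ≥0∞)
    (hF : ∀ j, Measurable (F j)) (hFp : ∀ j, ∫⁻ x, F j x ^ p ≠ ∞) (B : ℝ≥0∞)
    (hB : ((SS n).card : ℝ≥0∞) ≤ B) (hB' : ∀ s ∈ SS n, ((SS (-s)).card : ℝ≥0∞) ≤ B) :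
    ∫⁻ x, (∑ j, MM n (F j) x ^ 2) ^ (p / 2) ≤
      (CC 2 * B * (CC ((p / 2) / (p / 2 - 1)) * B) ^ (1 - 2 / p)) ^ (p / 2) *
        ∫⁻ x, (∑ j, F j x ^ 2) ^ (p / 2) := by
  set r := p / 2 with hr
  have hr1 : 1 < r := by rw [hr]; linarith
  set r' := r / (r - 1) with hr'
  have hr'1 : 1 < r' := by rw [hr', lt_div_iff₀ (by linarith)]; linarith
  have e0 : 1 - 2 / p = 1 / r' := by rw [hr', hr]; field_simp
  rw [e0]
  set G : ℝ → ℝ≥0∞ := fun x => ∑ j, MM n (F j) x ^ 2 with hG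
  set P : ℝ → ℝ≥0∞ := fun x => ∑ j, F j x ^ 2 with hP
  set X := ∫⁻ x, G x ^ r with hX
  set Y := ∫⁻ x, P x ^ r with hY
  have hGm : Measurable G := Finset.measurable_fun_sum _ fun j _ => (measurable_MM n (F j)).pow_const 2
  have hPm : Measurable P := Finset.measurable_fun_sum _ fun j _ => (hF j).pow_const 2
  have hXt : X ≠ ∞ := by
    have h1 : X ≤ ∫⁻ x, ((Finset.univ : Finset (Fin N)).card : ℝ≥0∞) ^ (r - 1) *
        ∑ j, MM n (F j) x ^ p := by
      refine lintegral_mono fun x => ?_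
      refine (ENNReal.rpow_sum_le_const_mul_sum_rpow _ _ hr1.le).trans (le_of_eq ?_)
      congr 1
      refine Finset.sum_congr rfl fun j _ => ?_
      rw [← ENNReal.rpow_two, ← ENNReal.rpow_mul]
      congr 1; rw [hr]; ring
    refine ne_top_of_le_ne_top ?_ h1
    rw [lintegral_const_mul _ (Finset.measurable_fun_sum _ fun j _ =>
      (measurable_MM n (F j)).pow_const p), lintegral_finsetSum _ fun j _ =>
      (measurable_MM n (F j)).pow_const p]
    refine ENNReal.mul_ne_top (ENNReal.rpow_ne_top_of_nonneg (by linarith) (by simp)) ?_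
    refine (ENNReal.sum_lt_top.2 fun j _ => ?_).ne
    refine (scalar (by linarith) n (hF j)).trans_lt ?_
    exact ENNReal.mul_lt_top (ENNReal.mul_lt_top (CC_ne_top (by linarith)).lt_top (by simp))
      (hFp j).lt_top
  set w : ℝ → ℝ≥0∞ := fun x => G x ^ (r - 1) with hw
  have hwm : Measurable w := hGm.pow_const _
  have hww : ∀ x, w x ^ r' = G x ^ r := by
    intro x
    rw [hw]; simp only
    rw [← ENNReal.rpow_mul]
    congr 1
    rw [hr']; field_simp [(by linarith : r - 1 ≠ 0)]
  have hmain : X ≤ CC 2 * B * (CC r' * B) ^ (1 / r') * Y ^ (1 / r) * X ^ (1 / r') := by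
    calc X = ∫⁻ x, ∑ j, MM n (F j) x ^ (2:ℝ) * w x := by
          rw [hX]
          refine lintegral_congr fun x => ?_
          rw [← Finset.sum_mul]
          simp_rw [ENNReal.rpow_two]
          change G x ^ r = G x * G x ^ (r - 1)
          nth_rw 2 [← ENNReal.rpow_one (G x)]
          rw [← ENNReal.rpow_add_of_nonneg _ _ zero_le_one (by linarith)]
          congr 1; ring
      _ = ∑ j, ∫⁻ x, MM n (F j) x ^ (2:ℝ) * w x :=
          lintegral_finsetSum _ fun j _ => ((measurable_MM n (F j)).pow_const _).mul hwm
      _ ≤ ∑ j, CC 2 * ∑ s ∈ SS n, ∫⁻ y, F j y ^ (2:ℝ) * MM (-s) w y :=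
          Finset.sum_le_sum fun j _ => strong (by norm_num) n (hF j) hwm
      _ = CC 2 * ∑ s ∈ SS n, ∫⁻ y, P y * MM (-s) w y := by
          rw [← Finset.mul_sum, Finset.sum_comm]
          congr 1
          refine Finset.sum_congr rfl fun s _ => ?_
          have hm : ∀ j ∈ (Finset.univ : Finset (Fin N)),
              Measurable (fun y => F j y ^ (2:ℝ) * MM (-s) w y) := fun j _ =>
            ((hF j).pow_const _).mul (measurable_MM _ _)
          rw [← lintegral_finsetSum _ hm]
          refine lintegral_congr fun y => ?_
          rw [← Finset.sum_mul]
          simp_rw [ENNReal.rpow_two, hP]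
      _ ≤ CC 2 * ∑ s ∈ SS n, Y ^ (1 / r) * (CC r' * B * X) ^ (1 / r') := by
          gcongr with s hs
          have := ENNReal.lintegral_mul_le_Lp_mul_Lq volume (p := r) (q := r')
            (Real.HolderConjugate.conjExponent hr1) hPm.aemeasurable
            (measurable_MM (-s) w).aemeasurable
          refine this.trans ?_
          gcongr
          refine (scalar hr'1 (-s) hwm).trans ?_
          simp_rw [hww]
          gcongr
          exact hB' s hs
      _ ≤ CC 2 * (B * (Y ^ (1 / r) * (CC r' * B * X) ^ (1 / r'))) := by
          rw [Finset.sum_const, nsmul_eq_mul]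
          gcongr
      _ = _ := by
          rw [ENNReal.mul_rpow_of_nonneg _ X (by positivity)]
          ring
  by_cases hX0 : X = 0
  · rw [hX0]; exact zero_le
  have hsum : 1 / r + 1 / r' = 1 := by
    rw [hr']; field_simp; ring
  have h2 : X ^ (1 / r) ≤ CC 2 * B * (CC r' * B) ^ (1 / r') * Y ^ (1 / r) := by
    have hne0 : X ^ (1 / r') ≠ 0 := by
      simp [hX0, hXt]
    have hnet : X ^ (1 / r') ≠ ∞ := ENNReal.rpow_ne_top_of_nonneg (by positivity) hXt
    rw [← ENNReal.mul_le_mul_iff_left hne0 hnet, ← ENNReal.rpow_add_of_nonneg _ _ (by positivity)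
      (by positivity), hsum, ENNReal.rpow_one]
    exact hmain
  calc X = (X ^ (1 / r)) ^ r := by
        rw [← ENNReal.rpow_mul, one_div_mul_cancel (by linarith), ENNReal.rpow_one]
    _ ≤ (CC 2 * B * (CC r' * B) ^ (1 / r') * Y ^ (1 / r)) ^ r := by gcongr
    _ = _ := by
        rw [ENNReal.mul_rpow_of_nonneg _ _ (by linarith), ← ENNReal.rpow_mul _ _ r,
          one_div_mul_cancel (by linarith), ENNReal.rpow_one]

lemma rubio {p : ℝ} (hp : 1 < p) (n : ℤ) {Q : ℝ≥0∞} (hQ0 : Q ≠ 0) (hQt : Q ≠ ∞)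
    (hQ : ∀ f : ℝ → ℝ≥0∞, Measurable f → ∫⁻ x, MM n f x ^ p ≤ Q * ∫⁻ x, f x ^ p)
    {F : ℝ → ℝ≥0∞} (hF : Measurable F) :
    ∃ g : ℝ → ℝ≥0∞, Measurable g ∧ (∀ x, F x ≤ g x) ∧ (∀ x, MM n g x ≤ 4 * Q ^ (1 / p) * g x) ∧
      ∫⁻ x, g x ^ p ≤ 2 ^ p * 2 * ∫⁻ x, F x ^ p := by
  set K := Q ^ (1 / p) with hK
  have hK0 : K ≠ 0 := by simp [hK, hQ0, hQt]
  have hKt : K ≠ ∞ := ENNReal.rpow_ne_top_of_nonneg (by positivity) hQt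
  have hKp : K ^ p = Q := by
    rw [hK, ← ENNReal.rpow_mul, one_div_mul_cancel (by linarith), ENNReal.rpow_one]
  have h4K0 : 4 * K ≠ 0 := mul_ne_zero (by norm_num) hK0
  have h4Kt : 4 * K ≠ ∞ := ENNReal.mul_ne_top (by norm_num) hKt
  set It : ℕ → ℝ → ℝ≥0∞ := fun k => (MM n)^[k] F with hIt
  have hIts : ∀ k, It (k + 1) = MM n (It k) := fun k => Function.iterate_succ_apply' _ _ _
  have hItm : ∀ k, Measurable (It k) := by
    intro k
    cases k with
    | zero => exact hF
    | succ k => rw [hIts]; exact measurable_MM _ _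
  have hItp : ∀ k, ∫⁻ x, It k x ^ p ≤ Q ^ k * ∫⁻ x, F x ^ p := by
    intro k
    induction k with
    | zero => simp [hIt]
    | succ k ih =>
      rw [hIts]
      refine (hQ _ (hItm k)).trans ?_
      rw [pow_succ', mul_assoc]
      gcongr
  set A : ℕ → ℝ → ℝ≥0∞ := fun k x => ((4 * K)⁻¹) ^ k * It k x with hA
  have hAm : ∀ k, Measurable (A k) := fun k => (hItm k).const_mul _
  refine ⟨fun x => ∑' k, A k x, Measurable.tsum hAm, ?_, ?_, ?_⟩
  · intro x
    refine le_trans ?_ (ENNReal.le_tsum 0)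
    simp [hA, hIt]
  · intro x
    refine (MM_tsum_le A hAm x).trans ?_
    calc ∑' k, MM n (A k) x ≤ ∑' k, 4 * K * A (k + 1) x := by
          refine ENNReal.tsum_le_tsum fun k => ?_
          refine (MM_const_mul_le _ (hItm k) _ x).trans (le_of_eq ?_)
          simp only [hA]
          rw [hIts, pow_succ', ← mul_assoc, ← mul_assoc, ENNReal.mul_inv_cancel h4K0 h4Kt, one_mul]
      _ = 4 * K * ∑' k, A (k + 1) x := ENNReal.tsum_mul_left
      _ ≤ _ := by
          gcongr
          exact ENNReal.tsum_comp_le_tsum_of_injective (f := fun k : ℕ => k + 1)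
            (add_left_injective 1) (fun k => A k x)
  · have hpt : ∀ x, (∑' k, A k x) ^ p ≤ 2 ^ p * ∑' k, (2 ^ k * A k x) ^ p := by
      intro x
      set z := ∑' k, (2 ^ k * A k x) ^ p with hz
      have h1 : ∀ k, A k x ≤ (2⁻¹) ^ k * z ^ (1 / p) := by
        intro k
        have h2 : (2 ^ k * A k x) ≤ z ^ (1 / p) := by
          rw [one_div, ENNReal.le_rpow_inv_iff (by linarith)]
          exact ENNReal.le_tsum (f := fun k => (2 ^ k * A k x) ^ p) k
        calc A k x = (2⁻¹) ^ k * (2 ^ k * A k x) := by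
              rw [← mul_assoc, ← mul_pow, ENNReal.inv_mul_cancel (by norm_num) (by norm_num),
                one_pow, one_mul]
          _ ≤ _ := by gcongr
      have h3 : ∑' k, A k x ≤ 2 * z ^ (1 / p) := by
        refine (ENNReal.tsum_le_tsum h1).trans ?_
        rw [ENNReal.tsum_mul_right, ENNReal.tsum_geometric, ENNReal.one_sub_inv_two, inv_inv]
      calc _ ≤ (2 * z ^ (1 / p)) ^ p := by gcongr
        _ = _ := by
          rw [ENNReal.mul_rpow_of_nonneg _ _ (by linarith), ← ENNReal.rpow_mul,
            one_div_mul_cancel (by linarith), ENNReal.rpow_one]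
    have hrho : (2 * (4 * K)⁻¹) ^ p * Q ≤ 2⁻¹ := by
      have e1 : 2 * (4 * K)⁻¹ = 2⁻¹ * K⁻¹ := by
        have : (4:ℝ≥0∞) * K = 2 * (2 * K) := by rw [← mul_assoc]; norm_num
        rw [this, ENNReal.mul_inv (by simp) (by simp), ← mul_assoc,
          ENNReal.mul_inv_cancel (by norm_num) (by norm_num), one_mul,
          ENNReal.mul_inv (by simp) (by simp)]
      rw [e1, ENNReal.mul_rpow_of_nonneg _ _ (by linarith), ENNReal.inv_rpow K, hKp, mul_assoc,
        ENNReal.inv_mul_cancel hQ0 hQt, mul_one]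
      nth_rw 2 [← ENNReal.rpow_one (2⁻¹)]
      exact ENNReal.rpow_le_rpow_of_exponent_ge (by norm_num) hp.le
    calc ∫⁻ x, (∑' k, A k x) ^ p ≤ ∫⁻ x, 2 ^ p * ∑' k, (2 ^ k * A k x) ^ p := lintegral_mono hpt
      _ = 2 ^ p * ∑' k, ∫⁻ x, (2 ^ k * A k x) ^ p := by
          rw [lintegral_const_mul _ (Measurable.tsum fun k =>
            ((hAm k).const_mul _).pow_const p), lintegral_tsum fun k =>
            (((hAm k).const_mul _).pow_const p).aemeasurable]
      _ ≤ 2 ^ p * ∑' k, (2⁻¹) ^ k * ∫⁻ x, F x ^ p := by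
          gcongr with k
          calc ∫⁻ x, (2 ^ k * A k x) ^ p
              = ∫⁻ x, ((2 * (4 * K)⁻¹) ^ p) ^ k * It k x ^ p := by
                refine lintegral_congr fun x => ?_
                simp only [hA]
                rw [← mul_assoc, ← mul_pow, ENNReal.mul_rpow_of_nonneg _ _ (by linarith),
                  ← ENNReal.rpow_natCast, ← ENNReal.rpow_natCast, ← ENNReal.rpow_mul,
                  ← ENNReal.rpow_mul, mul_comm p]
            _ = ((2 * (4 * K)⁻¹) ^ p) ^ k * ∫⁻ x, It k x ^ p :=
                lintegral_const_mul _ ((hItm k).pow_const p)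
            _ ≤ ((2 * (4 * K)⁻¹) ^ p) ^ k * (Q ^ k * ∫⁻ x, F x ^ p) := by
                gcongr; exact hItp k
            _ = ((2 * (4 * K)⁻¹) ^ p * Q) ^ k * ∫⁻ x, F x ^ p := by rw [mul_pow, mul_assoc]
            _ ≤ _ := by gcongr
      _ = _ := by
          rw [ENNReal.tsum_mul_right, ENNReal.tsum_geometric, ENNReal.one_sub_inv_two, inv_inv,
            mul_assoc]


lemma caseLT {p : ℝ} (hp : 1 < p) (hp2 : p < 2) (n : ℤ) {N : ℕ} (F : Fin N → ℝ → ℝ≥0∞)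
    (hF : ∀ j, Measurable (F j)) {Q : ℝ≥0∞} (hQ0 : Q ≠ 0) (hQt : Q ≠ ∞)
    (hQ : ∀ f : ℝ → ℝ≥0∞, Measurable f → ∫⁻ x, MM n f x ^ p ≤ Q * ∫⁻ x, f x ^ p) :
    ∫⁻ x, (∑ j, MM n (F j) x ^ 2) ^ (p / 2) ≤
      (4 ^ ((2 - p) * (p / 2)) * (2 ^ p * 2) ^ (1 - p / 2)) * Q *
        ∫⁻ x, (∑ j, F j x ^ 2) ^ (p / 2) := by
  set P : ℝ → ℝ≥0∞ := fun x => ∑ j, F j x ^ 2 with hP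
  have hPm : Measurable P := Finset.measurable_fun_sum _ fun j _ => (hF j).pow_const 2
  set Y := ∫⁻ x, P x ^ (p / 2) with hY
  by_cases hYt : Y = ∞
  · rw [hYt, ENNReal.mul_top]
    · exact le_top
    · refine mul_ne_zero (mul_ne_zero ?_ ?_) hQ0
      · exact (ENNReal.rpow_pos (by norm_num) (by norm_num)).ne'
      · refine (ENNReal.rpow_pos ?_ ?_).ne'
        · exact pos_iff_ne_zero.2 (mul_ne_zero (ENNReal.rpow_pos (by norm_num) (by norm_num)).ne'
            (by norm_num))
        · exact ENNReal.mul_ne_top (ENNReal.rpow_ne_top_of_nonneg (by linarith) (by norm_num))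
            (by norm_num)
  obtain ⟨g, hgm, hFg, hMg, hgp⟩ := rubio hp n hQ0 hQt hQ (F := fun x => P x ^ (1 / 2 : ℝ))
    (hPm.pow_const _)
  have hPp : ∀ x, (P x ^ (1 / 2 : ℝ)) ^ p = P x ^ (p / 2) := by
    intro x
    rw [← ENNReal.rpow_mul]; congr 1; ring
  simp_rw [hPp] at hgp
  have hgt : ∀ᵐ x ∂volume, g x < ∞ := by
    have h1 : ∫⁻ x, g x ^ p ≠ ∞ := by
      refine ne_top_of_le_ne_top ?_ hgp
      exact ENNReal.mul_ne_top (ENNReal.mul_ne_top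
        (ENNReal.rpow_ne_top_of_nonneg (by linarith) (by norm_num)) (by norm_num)) hYt
    filter_upwards [ae_lt_top' (hgm.pow_const p).aemeasurable h1] with x hx
    exact (ENNReal.rpow_lt_top_iff_of_pos (by linarith)).1 hx
  set K := Q ^ (1 / p) with hK
  set u : Fin N → ℝ → ℝ≥0∞ := fun j x => F j x ^ (2 / p) * g x ^ (-(2 - p) / p) with hu
  have hum : ∀ j, Measurable (u j) := fun j => ((hF j).pow_const _).mul (hgm.pow_const _)
  have hle : ∀ j x, F j x ≤ g x := by
    intro j x
    refine le_trans ?_ (hFg x)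
    rw [one_div, ENNReal.le_rpow_inv_iff (by norm_num), ENNReal.rpow_two]
    exact Finset.single_le_sum (f := fun j => F j x ^ 2) (fun _ _ => zero_le) (Finset.mem_univ j)
  have hfac : ∀ j, ∀ᵐ x ∂volume, F j x = u j x ^ (p / 2) * g x ^ (1 - p / 2) := by
    intro j
    filter_upwards [hgt] with x hx
    simp only [hu]
    rw [ENNReal.mul_rpow_of_nonneg _ _ (by linarith), ← ENNReal.rpow_mul, ← ENNReal.rpow_mul]
    have e1 : 2 / p * (p / 2) = 1 := by field_simp
    have e2 : -(2 - p) / p * (p / 2) = -(1 - p / 2) := by field_simp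
    rw [e1, e2, ENNReal.rpow_one]
    rcases eq_or_ne (g x) 0 with h0 | h0
    · have : F j x = 0 := le_antisymm (h0 ▸ hle j x) zero_le
      rw [this]; simp
    · rw [mul_assoc, ← ENNReal.rpow_add _ _ h0 hx.ne]
      simp
  have hup : ∀ j x, u j x ^ p = F j x ^ 2 * g x ^ (-(2 - p)) := by
    intro j x
    simp only [hu]
    rw [ENNReal.mul_rpow_of_nonneg _ _ (by linarith), ← ENNReal.rpow_mul, ← ENNReal.rpow_mul,
      ← ENNReal.rpow_two]
    have e1 : 2 / p * p = 2 := by field_simp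
    have e2 : -(2 - p) / p * p = -(2 - p) := by field_simp
    rw [e1, e2]
  set V : ℝ → ℝ≥0∞ := fun x => ∑ j, MM n (u j) x ^ p with hV
  have hVm : Measurable V :=
    Finset.measurable_fun_sum _ fun j _ => (measurable_MM n (u j)).pow_const p
  have hVi : ∫⁻ x, V x ≤ Q * Y := by
    calc ∫⁻ x, V x = ∑ j, ∫⁻ x, MM n (u j) x ^ p :=
          lintegral_finsetSum _ fun j _ => (measurable_MM n (u j)).pow_const p
      _ ≤ ∑ j, Q * ∫⁻ x, u j x ^ p := Finset.sum_le_sum fun j _ => hQ _ (hum j)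
      _ = Q * ∫⁻ x, P x * g x ^ (-(2 - p)) := by
          rw [← Finset.mul_sum, ← lintegral_finsetSum _ fun j _ => (hum j).pow_const p]
          simp_rw [hup, ← Finset.sum_mul, hP]
      _ ≤ Q * Y := by
          gcongr
          refine lintegral_mono fun x => ?_
          simp only
          rcases eq_or_ne (P x) 0 with h0 | h0
          · simp [h0]
          rcases eq_or_ne (P x) ∞ with ht | ht
          · rw [ht, ENNReal.top_rpow_of_pos (by linarith)]; exact le_top
          calc P x * g x ^ (-(2 - p)) ≤ P x * (P x ^ (1 / 2 : ℝ)) ^ (-(2 - p)) := by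
                gcongr P x * ?_
                rw [ENNReal.rpow_neg, ENNReal.rpow_neg]
                exact ENNReal.inv_le_inv.2 (ENNReal.rpow_le_rpow (hFg x) (by linarith))
            _ = P x ^ (p / 2) := by
                nth_rw 1 [← ENNReal.rpow_one (P x)]
                rw [← ENNReal.rpow_mul, ← ENNReal.rpow_add _ _ h0 ht]
                congr 1; ring
  have hpt : ∀ x, (∑ j, MM n (F j) x ^ 2) ^ (p / 2) ≤
      (4 * K) ^ ((2 - p) * (p / 2)) * ((g x ^ p) ^ (1 - p / 2) * V x ^ (p / 2)) := by
    intro x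
    have h1 : ∑ j, MM n (F j) x ^ 2 ≤ (4 * K * g x) ^ (2 - p) * V x := by
      simp only [hV]
      rw [Finset.mul_sum]
      refine Finset.sum_le_sum fun j _ => ?_
      calc MM n (F j) x ^ 2 ≤ (MM n (u j) x ^ (p / 2) * MM n g x ^ (1 - p / 2)) ^ 2 := by
            gcongr
            exact MM_holder (hum j) hgm (by linarith) (by linarith) (by ring) (hfac j) x
        _ = MM n g x ^ (2 - p) * MM n (u j) x ^ p := by
            rw [mul_pow, ← ENNReal.rpow_two, ← ENNReal.rpow_two, ← ENNReal.rpow_mul,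
              ← ENNReal.rpow_mul, mul_comm]
            congr 2 <;> ring
        _ ≤ _ := by
            gcongr
            exact hMg x
    calc _ ≤ ((4 * K * g x) ^ (2 - p) * V x) ^ (p / 2) := by gcongr
      _ = _ := by
          rw [ENNReal.mul_rpow_of_nonneg _ _ (by linarith), ← ENNReal.rpow_mul,
            ENNReal.mul_rpow_of_nonneg (4 * K) (g x)
              (mul_nonneg (by linarith) (by linarith)), mul_assoc, ← ENNReal.rpow_mul (g x)]
          congr 3; ring_nf
  calc _ ≤ ∫⁻ x, (4 * K) ^ ((2 - p) * (p / 2)) * ((g x ^ p) ^ (1 - p / 2) * V x ^ (p / 2)) :=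
        lintegral_mono hpt
    _ = (4 * K) ^ ((2 - p) * (p / 2)) * ∫⁻ x, ((g x ^ p) ^ (1 - p / 2) * V x ^ (p / 2)) := by
        have hm : Measurable (fun x => (g x ^ p) ^ (1 - p / 2) * V x ^ (p / 2)) :=
          ((hgm.pow_const _).pow_const _).mul (hVm.pow_const _)
        rw [lintegral_const_mul _ hm]
    _ ≤ (4 * K) ^ ((2 - p) * (p / 2)) * ((∫⁻ x, g x ^ p) ^ (1 - p / 2) *
          (∫⁻ x, V x) ^ (p / 2)) := by
        gcongr
        exact ENNReal.lintegral_mul_norm_pow_le (hgm.pow_const p).aemeasurable hVm.aemeasurable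
          (by linarith) (by linarith) (by ring)
    _ ≤ (4 * K) ^ ((2 - p) * (p / 2)) * ((2 ^ p * 2 * Y) ^ (1 - p / 2) * (Q * Y) ^ (p / 2)) := by
        gcongr
        linarith
    _ = _ := by
        have hn : 0 ≤ 1 - p / 2 := by linarith
        have hn2 : 0 ≤ p / 2 := by linarith
        have hn3 : 0 ≤ (2 - p) * (p / 2) := mul_nonneg (by linarith) (by linarith)
        have e1 : K ^ ((2 - p) * (p / 2)) = Q ^ (1 - p / 2) := by
          rw [hK, ← ENNReal.rpow_mul]; congr 1; field_simp
        have e2 : ∀ z : ℝ≥0∞, z = z ^ (1 - p / 2) * z ^ (p / 2) := by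
          intro z
          rw [← ENNReal.rpow_add_of_nonneg _ _ hn hn2]; simp
        rw [ENNReal.mul_rpow_of_nonneg _ _ hn3, e1, ENNReal.mul_rpow_of_nonneg _ Y hn,
          ENNReal.mul_rpow_of_nonneg _ _ hn2]
        conv_rhs => rw [e2 Q, e2 Y]
        ring

/-- card bound -/
lemma card_bound (n s : ℤ) (hs : s.natAbs ≤ n.natAbs + 1) :
    ((SS s).card : ℝ≥0∞) ≤ ENNReal.ofReal (20 * Real.log (2 + |(n:ℝ)|)) := by
  have h1 := SS_card s
  have hl2 := Real.log_two_gt_d9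
  set m := n.natAbs with hm
  have hmn : |(n:ℝ)| = (m:ℝ) := by rw [hm]; simp
  rw [hmn]
  have hlog : (Nat.log 2 s.natAbs : ℝ) * Real.log 2 ≤ 2 * Real.log (2 + m) := by
    rcases Nat.eq_zero_or_pos s.natAbs with h0 | h0
    · rw [h0]; simp
      exact Real.log_nonneg (by linarith [Nat.cast_nonneg (α := ℝ) m])
    have h2 : (2:ℝ) ^ Nat.log 2 s.natAbs ≤ (2 + m) ^ 2 := by
      have : 2 ^ Nat.log 2 s.natAbs ≤ (2 + m) ^ 2 :=
        (Nat.pow_log_le_self 2 h0.ne').trans (by nlinarith)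
      exact_mod_cast this
    have h3 := Real.log_le_log (by positivity) h2
    rw [Real.log_pow, Real.log_pow] at h3
    exact_mod_cast h3
  have hl : Real.log 2 ≤ Real.log (2 + m) :=
    Real.log_le_log (by norm_num) (by linarith [Nat.cast_nonneg (α := ℝ) m])
  have h4 : ((SS s).card : ℝ) ≤ 20 * Real.log (2 + m) := by
    have h5 : ((SS s).card : ℝ) ≤ 2 * (Nat.log 2 s.natAbs + 2) := by exact_mod_cast h1
    have h6 : (0:ℝ) ≤ Nat.log 2 s.natAbs := by positivity
    nlinarith
  rw [← ENNReal.ofReal_natCast]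
  exact ENNReal.ofReal_le_ofReal h4

lemma core {p : ℝ} (hp : 1 < p) : ∃ c : ℝ≥0∞, c ≠ ∞ ∧ ∀ (n : ℤ) (N : ℕ) (F : Fin N → ℝ → ℝ≥0∞),
    (∀ j, Measurable (F j)) → (∀ j, ∫⁻ x, F j x ^ p ≠ ∞) →
    ∫⁻ x, (∑ j, MM n (F j) x ^ 2) ^ (p / 2) ≤
      c * ENNReal.ofReal (20 * Real.log (2 + |(n:ℝ)|)) ^ p *
        ∫⁻ x, (∑ j, F j x ^ 2) ^ (p / 2) := by
  have hB1 : ∀ n : ℤ, 1 ≤ ENNReal.ofReal (20 * Real.log (2 + |(n:ℝ)|)) := by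
    intro n
    rw [ENNReal.one_le_ofReal]
    have hl : Real.log 2 ≤ Real.log (2 + |(n:ℝ)|) :=
      Real.log_le_log (by norm_num) (by linarith [abs_nonneg (n:ℝ)])
    linarith [Real.log_two_gt_d9]
  have hBp : ∀ n : ℤ, ENNReal.ofReal (20 * Real.log (2 + |(n:ℝ)|)) ≤
      ENNReal.ofReal (20 * Real.log (2 + |(n:ℝ)|)) ^ p := by
    intro n
    nth_rw 1 [← ENNReal.rpow_one (ENNReal.ofReal (20 * Real.log (2 + |(n:ℝ)|)))]
    exact ENNReal.rpow_le_rpow_of_exponent_le (hB1 n) hp.le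
  have hcard : ∀ n : ℤ, ((SS n).card : ℝ≥0∞) ≤ ENNReal.ofReal (20 * Real.log (2 + |(n:ℝ)|)) :=
    fun n => card_bound n n (by omega)
  rcases lt_trichotomy p 2 with h | h | h
  · refine ⟨(4 ^ ((2 - p) * (p / 2)) * (2 ^ p * 2) ^ (1 - p / 2)) * CC p, ?_, ?_⟩
    · refine ENNReal.mul_ne_top (ENNReal.mul_ne_top ?_ ?_) (CC_ne_top hp)
      · exact ENNReal.rpow_ne_top_of_nonneg (mul_nonneg (by linarith) (by linarith)) (by norm_num)
      · refine ENNReal.rpow_ne_top_of_nonneg (by linarith) (ENNReal.mul_ne_top ?_ (by norm_num))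
        exact ENNReal.rpow_ne_top_of_nonneg (by linarith) (by norm_num)
    · intro n N F hF _
      have hpos : (CC p * ENNReal.ofReal (20 * Real.log (2 + |(n:ℝ)|))) ≠ 0 :=
        mul_ne_zero (zero_lt_one.trans_le (one_le_CC hp)).ne' (zero_lt_one.trans_le (hB1 n)).ne'
      refine (caseLT hp h n F hF hpos (ENNReal.mul_ne_top (CC_ne_top hp) ENNReal.ofReal_ne_top)
        ?_).trans ?_
      · intro f hf
        refine (scalar hp n hf).trans ?_
        gcongr
        exact hcard n
      · rw [← mul_assoc]
        gcongr
        exact hBp n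
  · subst h
    refine ⟨CC 2, CC_ne_top hp, ?_⟩
    intro n N F hF _
    simp only [div_self (two_ne_zero' ℝ), ENNReal.rpow_one]
    rw [lintegral_finsetSum _ fun j _ => (measurable_MM n (F j)).pow_const 2,
      lintegral_finsetSum _ fun j _ => (hF j).pow_const 2, Finset.mul_sum]
    refine Finset.sum_le_sum fun j _ => ?_
    have := scalar hp n (hF j)
    simp only [ENNReal.rpow_two] at this
    refine this.trans ?_
    gcongr
    exact (hcard n).trans (by simpa using hBp n)
  · refine ⟨(CC 2 * (CC ((p / 2) / (p / 2 - 1))) ^ (1 - 2 / p)) ^ (p / 2), ?_, ?_⟩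
    · have h1 : 1 < (p / 2) / (p / 2 - 1) := by rw [lt_div_iff₀ (by linarith)]; linarith
      have h2 : 0 ≤ 1 - 2 / p := by
        rw [sub_nonneg, div_le_one (by linarith)]; linarith
      exact ENNReal.rpow_ne_top_of_nonneg (by linarith) (ENNReal.mul_ne_top
        (CC_ne_top (by norm_num)) (ENNReal.rpow_ne_top_of_nonneg h2 (CC_ne_top h1)))
    · intro n N F hF hFp
      have h2 : 0 ≤ 1 - 2 / p := by
        rw [sub_nonneg, div_le_one (by linarith)]; linarith
      refine (caseGT h n F hF hFp _ (hcard n) ?_).trans ?_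
      · intro s hs
        exact card_bound n (-s) (by rw [Int.natAbs_neg]; exact abs_mem_SS hs)
      · gcongr
        set B := ENNReal.ofReal (20 * Real.log (2 + |(n:ℝ)|)) with hB
        have e : B ^ p = (B ^ (2:ℝ)) ^ (p / 2) := by rw [← ENNReal.rpow_mul]; congr 1; ring
        rw [e, ← ENNReal.mul_rpow_of_nonneg _ _ (by linarith)]
        refine ENNReal.rpow_le_rpow ?_ (by linarith)
        rw [ENNReal.mul_rpow_of_nonneg _ _ h2]
        calc _ ≤ CC 2 * B * (CC (p / 2 / (p / 2 - 1)) ^ (1 - 2 / p) * B ^ (1:ℝ)) := by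
              gcongr
              · exact hB1 n
              · have : 0 < 2 / p := by positivity
                linarith
          _ = _ := by rw [ENNReal.rpow_one, ENNReal.rpow_two]; ring

theorem stmt11 (p : ℝ) (hp : 1 < p) :
    ∃ C : ℝ, 0 < C ∧ ∀ (n : ℤ) (N : ℕ) (f : Fin N → ℝ → ℂ),
      (∀ j, MemLp (f j) (ENNReal.ofReal p) volume) →
      ∫⁻ x : ℝ, (∑ j, (shiftedMaximal n (f j) x) ^ 2) ^ (p / 2) ≤
        ENNReal.ofReal (C * (Real.log (2 + |(n : ℝ)|)) ^ 2) ^ p *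
          ∫⁻ x : ℝ, (∑ j, ((‖f j x‖₊ : ℝ≥0∞)) ^ 2) ^ (p / 2) := by
  obtain ⟨c, hc, hcore⟩ := core hp
  have hp0 : 0 < p := by linarith
  refine ⟨((c ^ (1 / p)).toReal + 1) * 40, by positivity, ?_⟩
  intro n N f hf
  choose g hgm hfg using fun j => (hf j).1.enorm
  have hMM : ∀ j, shiftedMaximal n (f j) = MM n (g j) := fun j => by
    rw [shiftedMaximal_eq]; exact MM_congr (hfg j)
  have hfin : ∀ j, ∫⁻ x, g j x ^ p ≠ ∞ := by
    intro j
    have h1 := (eLpNorm_lt_top_iff_lintegral_rpow_enorm_lt_top (by simpa using hp0)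
      ENNReal.ofReal_ne_top).1 (hf j).eLpNorm_lt_top
    rw [ENNReal.toReal_ofReal hp0.le] at h1
    refine ne_of_lt (lt_of_eq_of_lt (lintegral_congr_ae ?_) h1)
    filter_upwards [hfg j] with x hx
    rw [← hx]
  have hY : ∫⁻ x : ℝ, (∑ j, ((‖f j x‖₊ : ℝ≥0∞)) ^ 2) ^ (p / 2) =
      ∫⁻ x : ℝ, (∑ j, g j x ^ 2) ^ (p / 2) := by
    refine lintegral_congr_ae ?_
    filter_upwards [ae_all_iff.2 hfg] with x hx
    have hx2 : ∀ j, (‖f j x‖₊ : ℝ≥0∞) = g j x := hx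
    simp only [hx2]
  rw [hY]
  simp_rw [hMM]
  refine (hcore n N g hgm hfin).trans ?_
  gcongr
  have e : c = (c ^ (1 / p)) ^ p := by
    rw [← ENNReal.rpow_mul, one_div_mul_cancel hp0.ne', ENNReal.rpow_one]
  have hct : c ^ (1 / p) ≠ ∞ := ENNReal.rpow_ne_top_of_nonneg (by positivity) hc
  set b := c ^ (1 / p) with hb
  rw [e, ← ENNReal.mul_rpow_of_nonneg _ _ hp0.le]
  gcongr
  rw [← ENNReal.ofReal_toReal hct, ← ENNReal.ofReal_mul ENNReal.toReal_nonneg]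
  refine ENNReal.ofReal_le_ofReal ?_
  rw [ENNReal.toReal_ofReal ENNReal.toReal_nonneg]
  have hl : Real.log 2 ≤ Real.log (2 + |(n:ℝ)|) :=
    Real.log_le_log (by norm_num) (by linarith [abs_nonneg (n:ℝ)])
  have hl2 := Real.log_two_gt_d9
  set l := Real.log (2 + |(n:ℝ)|) with hlq
  have h1 : 20 * l ≤ 40 * l ^ 2 := by nlinarith
  have h0 : 0 ≤ b.toReal := ENNReal.toReal_nonneg
  calc b.toReal * (20 * l) ≤ b.toReal * (40 * l ^ 2) := by gcongr
    _ ≤ (b.toReal + 1) * (40 * l ^ 2) := by gcongr; linarith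
    _ = _ := by ring
end

section
/- Let $n\in\mathbb{Z}$. Then for every $N\ge 1$ and all $f_1,\dots,f_N\in L^1(\mathbb{R})$ one has the weak-type endpoint estimate: for every $\alpha>0$, $\alpha\cdot\big|\big\{x:\big(\sum_{j=1}^N |M_n f_j(x)|^2\big)^{1/2}>\alpha\big\}\big|\le C\,\log^2\langle n\rangle\,\big\|\big(\sum_{j=1}^N |f_j|^2\big)^{1/2}\big\|_{L^1}$, where $C$ is an absolute constant (independent of $N$ and $n$). -/
open MeasureTheory ENNReal

namespace Sh
open Set Filter Topology

def dI (k m : ℤ) : Set ℝ := Ico ((2:ℝ)^k * m) ((2:ℝ)^k * (m+1))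

noncomputable def w (k : ℤ) : ℝ≥0∞ := ENNReal.ofReal ((2:ℝ)^k)

noncomputable def av (h : ℝ → ℝ≥0∞) (k m : ℤ) : ℝ≥0∞ := (w k)⁻¹ * ∫⁻ y in dI k m, h y

noncomputable def SM (n : ℤ) (h : ℝ → ℝ≥0∞) (x : ℝ) : ℝ≥0∞ :=
  ⨆ (k : ℤ) (m : ℤ) (_ : x ∈ dI k m), av h k (m + n)

lemma p2 (k : ℤ) : (0:ℝ) < (2:ℝ)^k := by positivity

lemma w_pos (k : ℤ) : w k ≠ 0 := by
  simp [w, p2]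

lemma w_top (k : ℤ) : w k ≠ ∞ := by simp [w]

lemma meas_dI (k m : ℤ) : MeasurableSet (dI k m) := measurableSet_Ico

lemma vol_dI (k m : ℤ) : volume (dI k m) = w k := by
  rw [dI, Real.volume_Ico, w]; congr 1; ring

lemma mem_dI (k m : ℤ) (x : ℝ) : x ∈ dI k m ↔ ⌊x / 2^k⌋ = m := by
  rw [Int.floor_eq_iff, dI, mem_Ico, le_div_iff₀ (p2 k), div_lt_iff₀ (p2 k)]
  constructor <;> rintro ⟨h1, h2⟩ <;> constructor <;> nlinarith

lemma floor_succ (k : ℤ) (d : ℕ) (x : ℝ) : ⌊x / 2^(k+d)⌋ = ⌊x/2^k⌋ / (2^d : ℤ) := by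
  have := Int.floor_div_natCast (x/2^k) (2^d)
  push_cast at this
  rw [← this, zpow_add₀ (by norm_num), div_div]
  simp

lemma dI_nest {k k' m m' : ℤ} (hk : k ≤ k') {x : ℝ} (h1 : x ∈ dI k m) (h2 : x ∈ dI k' m') :
    dI k m ⊆ dI k' m' := by
  intro y hy
  obtain ⟨d, rfl⟩ := Int.le.dest hk
  rw [mem_dI] at *
  rw [floor_succ] at *
  rw [hy, ← h1, h2]

lemma left_mem (k m : ℤ) : (2:ℝ)^k * m ∈ dI k m := by
  rw [dI, mem_Ico]; have := p2 k; constructor <;> nlinarith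

lemma dI_sub_le {k k' m m' : ℤ} (h : dI k m ⊆ dI k' m') : k ≤ k' := by
  have := measure_mono (μ := volume) h
  rw [vol_dI, vol_dI, w, w, ENNReal.ofReal_le_ofReal_iff (p2 _).le] at this
  exact (zpow_le_zpow_iff_right₀ (by norm_num)).1 this

lemma w_mul_av (h : ℝ → ℝ≥0∞) (k m : ℤ) : w k * av h k m = ∫⁻ y in dI k m, h y := by
  rw [av, ← mul_assoc, ENNReal.mul_inv_cancel (w_pos k) (w_top k), one_mul]

/-- selected intervals -/
def Sel (h : ℝ → ℝ≥0∞) (a : ℝ≥0∞) : Set (ℤ × ℤ) := {q | a < av h q.1 q.2}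

/-- maximal selected intervals -/
def SMax (h : ℝ → ℝ≥0∞) (a : ℝ≥0∞) : Set (ℤ × ℤ) :=
  {q | q ∈ Sel h a ∧ ∀ q' ∈ Sel h a, dI q.1 q.2 ⊆ dI q'.1 q'.2 → q' = q}

lemma exists_max {h : ℝ → ℝ≥0∞} {a : ℝ≥0∞} (ha : a ≠ 0) (hh : ∫⁻ x, h x ≠ ∞)
    {q : ℤ × ℤ} (hq : q ∈ Sel h a) : ∃ q' ∈ SMax h a, dI q.1 q.2 ⊆ dI q'.1 q'.2 := by
  have hb : ∃ b : ℤ, ∀ z : ℤ, (∃ m, (z, m) ∈ Sel h a ∧ dI q.1 q.2 ⊆ dI z m) → z ≤ b := by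
    obtain ⟨N, hN⟩ := pow_unbounded_of_one_lt ((∫⁻ x, h x) / a).toReal (one_lt_two (α := ℝ))
    refine ⟨N, ?_⟩
    rintro k ⟨m, hm, -⟩
    by_contra hlt
    push Not at hlt
    have h1 : a < av h k m := hm
    have h2 : w k * a < ∫⁻ x, h x := by
      calc w k * a < w k * av h k m := ENNReal.mul_lt_mul_right (w_pos k) (w_top k) h1
        _ = ∫⁻ y in dI k m, h y := w_mul_av h k m
        _ ≤ _ := setLIntegral_le_lintegral _ _
    have h3 : w k < (∫⁻ x, h x) / a := by
      rw [ENNReal.lt_div_iff_mul_lt (Or.inl ha) (Or.inr (w_pos k))]; exact h2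
    have h5 : (2:ℝ)^N ≤ (2:ℝ)^k := by
      rw [← zpow_natCast]; exact zpow_le_zpow_right₀ (by norm_num) hlt.le
    have h4 : (∫⁻ x, h x) / a ≠ ∞ := ENNReal.div_ne_top hh ha
    have h6 := (ENNReal.ofReal_lt_iff_lt_toReal (p2 k).le h4).1 h3
    linarith
  obtain ⟨K, ⟨m, hm, hsub⟩, hK⟩ := Int.exists_greatest_of_bdd
    (P := fun k => ∃ m, (k, m) ∈ Sel h a ∧ dI q.1 q.2 ⊆ dI k m) hb ⟨q.1, q.2, hq, subset_rfl⟩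
  · refine ⟨(K, m), ⟨hm, ?_⟩, hsub⟩
    rintro ⟨k', m'⟩ hq' hs
    have h1 := hK k' ⟨m', hq', hsub.trans hs⟩
    have h2 := dI_sub_le hs
    obtain rfl : k' = K := le_antisymm h1 h2
    have h3 := hs (left_mem _ _)
    have h4 := left_mem k' m
    rw [mem_dI] at h3 h4
    simp only at h3 h4
    rw [show m' = m from h3.symm.trans h4]

lemma max_disj (h : ℝ → ℝ≥0∞) (a : ℝ≥0∞) :
    (SMax h a).PairwiseDisjoint (fun q => dI q.1 q.2) := by
  have key : ∀ q ∈ SMax h a, ∀ q' ∈ SMax h a, q.1 ≤ q'.1 → q ≠ q' →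
      Disjoint (dI q.1 q.2) (dI q'.1 q'.2) := by
    intro q hq q' hq' hle hne
    rw [Set.disjoint_left]
    intro x hx hx'
    exact hne (hq.2 q' hq'.1 (dI_nest hle hx hx')).symm
  intro q hq q' hq' hne
  rcases le_total q.1 q'.1 with hle | hle
  · exact key q hq q' hq' hle hne
  · exact (key q' hq' q hq hle hne.symm).symm

lemma w_succ (k : ℤ) : w (k+1) = 2 * w k := by
  rw [w, w, zpow_add_one₀ (by norm_num), mul_comm, ENNReal.ofReal_mul (by norm_num)]; simp

lemma max_le {h : ℝ → ℝ≥0∞} {a : ℝ≥0∞} {q : ℤ × ℤ} (hq : q ∈ SMax h a) :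
    av h q.1 q.2 ≤ 2 * a := by
  obtain ⟨k, m⟩ := q
  have hsub : dI k m ⊆ dI (k+1) (m / 2) := by
    intro y hy
    rw [mem_dI] at *
    have := floor_succ k 1 y
    simp only [Nat.cast_one, pow_one] at this
    rw [this, hy]
  have hn : (k+1, m/2) ∉ Sel h a := by
    intro hs
    have := hq.2 _ hs hsub
    simp at this
  have hn' : av h (k+1) (m/2) ≤ a := not_lt.1 hn
  have h1 : w k * av h k m ≤ w k * (2 * a) := by
    rw [w_mul_av]
    calc _ ≤ ∫⁻ y in dI (k+1) (m/2), h y := lintegral_mono_set hsub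
      _ = w (k+1) * av h (k+1) (m/2) := (w_mul_av _ _ _).symm
      _ ≤ w (k+1) * a := by gcongr
      _ = _ := by rw [w_succ]; ring
  exact (ENNReal.mul_le_mul_iff_right (w_pos k) (w_top k)).1 h1

lemma sum_le (h : ℝ → ℝ≥0∞) (a : ℝ≥0∞) :
    a * ∑' q : SMax h a, w q.1.1 ≤ ∫⁻ x, h x := by
  rw [← ENNReal.tsum_mul_left]
  calc ∑' q : SMax h a, a * w q.1.1 ≤ ∑' q : SMax h a, ∫⁻ y in dI q.1.1 q.1.2, h y := by
        refine ENNReal.tsum_le_tsum fun q => ?_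
        rw [← w_mul_av, mul_comm]
        gcongr
        exact q.2.1.le
    _ = ∫⁻ y in ⋃ q : SMax h a, dI q.1.1 q.1.2, h y := by
        rw [lintegral_iUnion (fun q => meas_dI _ _)]
        exact (max_disj h a).subtype _ _
    _ ≤ _ := setLIntegral_le_lintegral _ _

def EJ (n k m : ℤ) : Set ℝ := ⋃ s : ℕ, {x : ℝ | x + n * 2^(k - s) ∈ dI k m}

lemma vol_EJ {n : ℤ} {L : ℕ} (hL : |(n:ℝ)| ≤ 2^L) (k m : ℤ) :
    volume (EJ n k m) ≤ (L + 3) * w k := by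
  have hsub : EJ n k m ⊆ (⋃ s ∈ Finset.range L, {x : ℝ | x + n * 2^(k - (s:ℕ)) ∈ dI k m}) ∪
      Ico ((2:ℝ)^k * (m-1)) ((2:ℝ)^k * (m+2)) := by
    intro x hx
    obtain ⟨s, hs⟩ := mem_iUnion.1 hx
    by_cases hsL : s < L
    · left
      simp only [mem_iUnion]
      exact ⟨s, Finset.mem_range.2 hsL, hs⟩
    · right
      push Not at hsL
      have h1 : |(n:ℝ)| * 2^(k-(s:ℤ)) ≤ 2^k := by
        have : (2:ℝ)^k = 2^s * 2^(k-(s:ℤ)) := by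
          rw [← zpow_natCast, ← zpow_add₀ (by norm_num)]; congr 1; ring
        rw [this]
        gcongr
        exact hL.trans (pow_le_pow_right₀ (by norm_num) hsL)
      have h2 : |(n:ℝ) * 2^(k-(s:ℤ))| ≤ 2^k := by
        rw [abs_mul, abs_of_pos (p2 _)]; exact h1
      obtain ⟨h3, h4⟩ := abs_le.1 h2
      have hs' : x + n * 2^(k - (s:ℤ)) ∈ dI k m := hs
      rw [dI, mem_Ico] at hs'
      rw [mem_Ico]
      constructor <;> nlinarith [hs'.1, hs'.2]
  calc volume (EJ n k m) ≤ _ := measure_mono hsub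
    _ ≤ _ := measure_union_le _ _
    _ ≤ (∑ s ∈ Finset.range L, w k) + 3 * w k := by
        gcongr
        · refine (measure_biUnion_finset_le _ _).trans (Finset.sum_le_sum fun s _ => le_of_eq ?_)
          have := measure_preimage_add_right (volume : Measure ℝ) ((n:ℝ) * 2^(k-(s:ℤ))) (dI k m)
          rw [vol_dI] at this
          exact this
        · rw [Real.volume_Ico, w, ← ENNReal.ofReal_ofNat, ← ENNReal.ofReal_mul (by norm_num)]
          apply le_of_eq; congr 1; ring
    _ = _ := by simp; ring

def EX (n : ℤ) (h : ℝ → ℝ≥0∞) (a : ℝ≥0∞) : Set ℝ := ⋃ q : SMax h a, EJ n q.1.1 q.1.2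

lemma vol_EX {n : ℤ} {L : ℕ} (hL : |(n:ℝ)| ≤ 2^L) (h : ℝ → ℝ≥0∞) (a : ℝ≥0∞) :
    a * volume (EX n h a) ≤ (L + 3) * ∫⁻ x, h x := by
  calc a * volume (EX n h a) ≤ a * ∑' q : SMax h a, (L+3) * w q.1.1 := by
        gcongr
        exact (measure_iUnion_le _).trans (ENNReal.tsum_le_tsum fun q => vol_EJ hL _ _)
    _ = (L+3) * (a * ∑' q : SMax h a, w q.1.1) := by rw [ENNReal.tsum_mul_left]; ring
    _ ≤ _ := by gcongr; exact sum_le h a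

lemma not_EX {n : ℤ} {h : ℝ → ℝ≥0∞} {a : ℝ≥0∞} {x : ℝ} (hx : x ∉ EX n h a) {k m : ℤ}
    (hm : x ∈ dI k m) : ∀ q ∈ SMax h a, ¬ dI k (m+n) ⊆ dI q.1 q.2 := by
  intro q hq hs
  apply hx
  have hle := dI_sub_le hs
  obtain ⟨d, hd⟩ := Int.le.dest hle
  refine mem_iUnion.2 ⟨⟨q, hq⟩, mem_iUnion.2 ⟨d, ?_⟩⟩
  have : q.1 - (d:ℤ) = k := by omega
  show x + n * 2^(q.1 - (d:ℤ)) ∈ dI q.1 q.2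
  rw [this]
  apply hs
  rw [dI, mem_Ico] at *
  push_cast
  constructor <;> nlinarith [hm.1, hm.2]

lemma weak {n : ℤ} {L : ℕ} (hL : |(n:ℝ)| ≤ 2^L) (h : ℝ → ℝ≥0∞) {a : ℝ≥0∞} (ha : a ≠ 0) :
    a * volume {x | a < SM n h x} ≤ (L + 3) * ∫⁻ x, h x := by
  by_cases hh : ∫⁻ x, h x = ∞
  · rw [hh, ENNReal.mul_top (by simp)]; exact le_top
  refine le_trans ?_ (vol_EX hL h a)
  gcongr
  intro x hx
  by_contra hc
  simp only [mem_ofPred_eq, SM, lt_iSup_iff] at hx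
  obtain ⟨k, m, hm, hlt⟩ := hx
  obtain ⟨q, hq, hs⟩ := exists_max (q := (k, m+n)) ha hh hlt
  exact not_EX hc hm q hq hs

lemma SM_meas (n : ℤ) (h : ℝ → ℝ≥0∞) : Measurable (SM n h) := by
  unfold SM
  refine Measurable.iSup fun k => Measurable.iSup fun m => ?_
  have : (fun x => ⨆ (_ : x ∈ dI k m), av h k (m+n)) =
      (dI k m).indicator (fun _ => av h k (m+n)) := by
    ext x
    by_cases hx : x ∈ dI k m <;> simp [hx]
  rw [this]
  exact measurable_const.indicator (meas_dI k m)

lemma SM_trunc (n : ℤ) (h : ℝ → ℝ≥0∞) {a : ℝ≥0∞} (x : ℝ)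
    (hx : a < SM n h x) :
    a / 2 < SM n ({y | a / 2 < h y}.indicator h) x := by
  simp only [SM, lt_iSup_iff] at hx ⊢
  obtain ⟨k, m, hm, hlt⟩ := hx
  refine ⟨k, m, hm, ?_⟩
  set g := {y | a / 2 < h y}.indicator h with hg
  have h1 : ∀ y, h y ≤ g y + a / 2 := by
    intro y
    by_cases hy : a / 2 < h y
    · simp [hg, hy]
    · simp [hg, hy]; exact not_lt.1 hy
  have h2 : av h k (m+n) ≤ av g k (m+n) + a / 2 := by
    unfold av
    calc _ ≤ (w k)⁻¹ * ∫⁻ y in dI k (m+n), (g y + a/2) := by gcongr with y; exact h1 y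
      _ = _ := by
        rw [lintegral_add_right _ measurable_const, mul_add, lintegral_const]
        congr 1
        rw [Measure.restrict_apply_univ, vol_dI, mul_comm, mul_assoc,
          ENNReal.mul_inv_cancel (w_pos k) (w_top k), mul_one]
  by_contra hc
  push Not at hc
  have h3 : av h k (m+n) ≤ a / 2 + a / 2 := h2.trans (by gcongr)
  rw [ENNReal.add_halves] at h3
  exact absurd hlt (not_lt.2 h3)

lemma SM_fin (n : ℤ) (h : ℝ → ℝ≥0∞) (hh : ∫⁻ x, h x ≠ ∞) : ∀ᵐ x, SM n h x ≠ ∞ := by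
  obtain ⟨L, hL⟩ := pow_unbounded_of_one_lt |(n:ℝ)| (one_lt_two (α := ℝ))
  rw [ae_iff]
  simp only [not_not]
  by_contra hne
  set V := volume {x | SM n h x = ∞} with hV
  have hC : ((L:ℝ≥0∞) + 3) * ∫⁻ x, h x ≠ ∞ := ENNReal.mul_ne_top (by simp) hh
  have h1 : ∀ N : ℕ, ((N:ℝ≥0∞) + 1) * V ≤ (L + 3) * ∫⁻ x, h x := by
    intro N
    refine le_trans ?_ (weak hL.le h (a := N + 1) (by simp))
    gcongr
    rw [hV]
    refine measure_mono ?_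
    intro x hx
    simp only [mem_ofPred_eq] at hx ⊢
    rw [hx]
    exact ENNReal.add_lt_top.2 ⟨by simp, by simp⟩
  obtain ⟨N, hN⟩ := ENNReal.exists_nat_mul_gt hne hC
  have := h1 N
  refine absurd (lt_of_lt_of_le hN ?_) (lt_irrefl ((L + 3) * ∫⁻ x, h x))
  refine le_trans ?_ this
  gcongr
  exact le_self_add

lemma inner_bd (c : ℝ≥0∞) :
    ∫⁻ t in Ioi (0:ℝ), (if ENNReal.ofReal t / 2 < c then c else 0) ≤ 2 * c ^ 2 := by
  by_cases hc : c = ∞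
  · simp [hc]
  have h1 : ∀ t : ℝ, (if ENNReal.ofReal t / 2 < c then c else 0) ≤
      (Iio (2 * c.toReal)).indicator (fun _ => c) t := by
    intro t
    split_ifs with ht
    · rw [indicator_of_mem]
      rw [ENNReal.div_lt_iff (by simp) (by simp)] at ht
      rw [mem_Iio]
      have h2 : c * 2 ≠ ∞ := ENNReal.mul_ne_top hc (by simp)
      by_contra hcon
      push Not at hcon
      have := ENNReal.ofReal_le_ofReal hcon
      rw [ENNReal.ofReal_mul (by norm_num), ENNReal.ofReal_toReal hc, ENNReal.ofReal_ofNat,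
        mul_comm] at this
      exact absurd ht (not_lt.2 this)
    · exact zero_le
  calc _ ≤ ∫⁻ t in Ioi (0:ℝ), (Iio (2 * c.toReal)).indicator (fun _ => c) t :=
        lintegral_mono h1
    _ = c * volume (Iio (2 * c.toReal) ∩ Ioi 0) := by
        rw [lintegral_indicator measurableSet_Iio, lintegral_const, Measure.restrict_restrict measurableSet_Iio,
          Measure.restrict_apply_univ]
    _ = 2 * c ^ 2 := by
        rw [inter_comm, Ioi_inter_Iio, Real.volume_Ioo, sub_zero, ENNReal.ofReal_mul (by norm_num),
          ENNReal.ofReal_toReal hc, ENNReal.ofReal_ofNat]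
        ring

lemma L2 {n : ℤ} {L : ℕ} (hL : |(n:ℝ)| ≤ 2^L) (h : ℝ → ℝ≥0∞) (hm : Measurable h)
    (hh : ∫⁻ x, h x ≠ ∞) :
    ∫⁻ x, (SM n h x) ^ 2 ≤ 8 * (L + 3) * ∫⁻ x, h x ^ 2 := by
  have hfin := SM_fin n h hh
  have e1 : ∫⁻ x, (SM n h x) ^ 2 = ∫⁻ x, ENNReal.ofReal ((SM n h x).toReal ^ (2:ℝ)) := by
    refine lintegral_congr_ae ?_
    filter_upwards [hfin] with x hx
    rw [← ENNReal.ofReal_rpow_of_nonneg ENNReal.toReal_nonneg (by norm_num),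
      ENNReal.ofReal_toReal hx]
    simp
  have key : ∀ t ∈ Ioi (0:ℝ), volume {x | t < (SM n h x).toReal} * ENNReal.ofReal (t ^ ((2:ℝ) - 1))
      ≤ 2 * (L+3) * ∫⁻ x, (if ENNReal.ofReal t / 2 < h x then h x else 0) := by
    intro t ht
    have ht0 : ENNReal.ofReal t ≠ 0 := by simpa using ht
    have h1 : volume {x | t < (SM n h x).toReal} ≤
        volume {x | ENNReal.ofReal t / 2 < SM n ({y | ENNReal.ofReal t / 2 < h y}.indicator h) x} := by
      refine measure_mono fun x hx => ?_
      refine SM_trunc n h x ?_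
      have hx' : t < (SM n h x).toReal := hx
      have hne : SM n h x ≠ ∞ := by
        intro hT
        rw [hT, ENNReal.toReal_top] at hx'
        exact absurd (mem_Ioi.1 ht) (not_lt.2 hx'.le)
      exact (ENNReal.ofReal_lt_iff_lt_toReal (le_of_lt ht) hne).2 hx'
    have h2 := weak hL ({y | ENNReal.ofReal t / 2 < h y}.indicator h) (a := ENNReal.ofReal t / 2)
      (by simpa using ht)
    have e : ENNReal.ofReal (t ^ ((2:ℝ) - 1)) = 2 * (ENNReal.ofReal t / 2) := by
      rw [ENNReal.mul_div_cancel (by simp) (by simp)]; norm_num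
    rw [e]
    calc _ ≤ volume {x | ENNReal.ofReal t / 2 < SM n ({y | ENNReal.ofReal t / 2 < h y}.indicator h) x} *
          (2 * (ENNReal.ofReal t / 2)) := by gcongr
      _ = 2 * (ENNReal.ofReal t / 2 * volume {x | ENNReal.ofReal t / 2 < SM n ({y | ENNReal.ofReal t / 2 < h y}.indicator h) x}) := by ring
      _ ≤ 2 * ((L + 3) * ∫⁻ x, ({y | ENNReal.ofReal t / 2 < h y}.indicator h) x) := by gcongr
      _ = _ := by
        rw [mul_assoc]; congr 3
        ext x
        simp [indicator]
  have hjm : Measurable (fun p : ℝ × ℝ => if ENNReal.ofReal p.1 / 2 < h p.2 then h p.2 else 0) := by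
    refine Measurable.ite ?_ (hm.comp measurable_snd) measurable_const
    exact measurableSet_lt (by fun_prop) (by fun_prop)
  rw [e1, lintegral_rpow_eq_lintegral_meas_lt_mul volume (Eventually.of_forall fun _ => ENNReal.toReal_nonneg)
    (SM_meas n h).ennreal_toReal.aemeasurable (by norm_num)]
  calc _ ≤ ENNReal.ofReal 2 * ∫⁻ t in Ioi (0:ℝ), 2 * (L+3) * ∫⁻ x, (if ENNReal.ofReal t / 2 < h x then h x else 0) := by
        gcongr ENNReal.ofReal 2 * ?_
        exact setLIntegral_mono' measurableSet_Ioi key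
    _ = 4 * (L+3) * ∫⁻ t in Ioi (0:ℝ), ∫⁻ x, (if ENNReal.ofReal t / 2 < h x then h x else 0) := by
        rw [lintegral_const_mul' _ _ (by finiteness), ENNReal.ofReal_ofNat]
        ring
    _ = 4 * (L+3) * ∫⁻ x, ∫⁻ t in Ioi (0:ℝ), (if ENNReal.ofReal t / 2 < h x then h x else 0) := by
        rw [lintegral_lintegral_swap]
        exact hjm.aemeasurable
    _ ≤ 4 * (L+3) * ∫⁻ x, 2 * h x ^ 2 := by
        gcongr with x; exact inner_bd (h x)
    _ = _ := by
        rw [lintegral_const_mul' _ _ (by finiteness)]; ring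

def Om (F : ℝ → ℝ≥0∞) (a : ℝ≥0∞) : Set ℝ := ⋃ q : SMax F a, dI q.1.1 q.1.2

lemma meas_Om (F : ℝ → ℝ≥0∞) (a : ℝ≥0∞) : MeasurableSet (Om F a) :=
  MeasurableSet.iUnion fun q => meas_dI _ _

lemma ae_le_Om {F : ℝ → ℝ≥0∞} (hF : Measurable F) (hf : ∫⁻ x, F x ≠ ∞) {a : ℝ≥0∞} (ha : a ≠ 0) :
    ∀ᵐ x, x ∉ Om F a → F x ≤ a := by
  filter_upwards [(IsUnifLocDoublingMeasure.vitaliFamily (volume : Measure ℝ) 1).ae_tendsto_lintegral_div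
    hF.aemeasurable hf] with x hx hxO
  have hδ : Tendsto (fun j : ℕ => (2:ℝ)^(-(j:ℤ)) / 2) atTop (𝓝[>] 0) := by
    refine tendsto_nhdsWithin_iff.2 ⟨?_, Eventually.of_forall fun j => ?_⟩
    · have := (tendsto_pow_atTop_nhds_zero_of_lt_one (r := (1/2:ℝ)) (by norm_num) (by norm_num)).div_const 2
      rw [zero_div] at this
      refine this.congr fun j => ?_
      simp
    · have := p2 (-(j:ℤ)); simp only [mem_Ioi]; positivity
  have hT := IsUnifLocDoublingMeasure.tendsto_closedBall_filterAt (volume : Measure ℝ) (K := 1) (x := x)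
    (fun j : ℕ => (2:ℝ)^(-(j:ℤ)) * (⌊x / 2^(-(j:ℤ))⌋ + 1/2)) _ hδ ?_
  · refine le_of_tendsto (hx.comp hT) (Eventually.of_forall fun j => ?_)
    set k := -(j:ℤ)
    set m := ⌊x / 2^k⌋ with hm
    have hxm : x ∈ dI k m := (mem_dI _ _ _).2 hm.symm
    have hball : Metric.closedBall ((2:ℝ)^k * (m + 1/2)) ((2:ℝ)^k / 2) =
        Icc ((2:ℝ)^k * m) ((2:ℝ)^k * (m+1)) := by
      rw [Real.closedBall_eq_Icc]; congr 1 <;> ring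
    have h1 : av F k m ≤ a := by
      by_contra hc
      obtain ⟨q, hq, hs⟩ := exists_max (q := (k, m)) ha hf (not_le.1 hc)
      exact hxO (mem_iUnion.2 ⟨⟨q, hq⟩, hs hxm⟩)
    simp only [Function.comp]
    rw [hball, ← setLIntegral_congr Ico_ae_eq_Icc, ← measure_congr Ico_ae_eq_Icc]
    have := vol_dI k m
    rw [dI] at this
    rw [this, ENNReal.div_eq_inv_mul]
    exact h1
  · refine Eventually.of_forall fun j => ?_
    have hxm : x ∈ dI (-(j:ℤ)) ⌊x / 2^(-(j:ℤ))⌋ := (mem_dI _ _ _).2 rfl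
    rw [dI, mem_Ico] at hxm
    rw [one_mul, Real.closedBall_eq_Icc, mem_Icc]
    constructor <;> linarith [hxm.1, hxm.2]

noncomputable def good (F : ℝ → ℝ≥0∞) (a : ℝ≥0∞) (h : ℝ → ℝ≥0∞) : ℝ → ℝ≥0∞ := fun x =>
  (Om F a)ᶜ.indicator h x + ∑' q : SMax F a, (dI q.1.1 q.1.2).indicator (fun _ => av h q.1.1 q.1.2) x

lemma good_meas (F : ℝ → ℝ≥0∞) (a : ℝ≥0∞) {h : ℝ → ℝ≥0∞} (hm : Measurable h) :
    Measurable (good F a h) := by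
  unfold good
  refine (hm.indicator (meas_Om F a).compl).add ?_
  exact Measurable.tsum fun q => measurable_const.indicator (meas_dI _ _)

lemma good_int (F : ℝ → ℝ≥0∞) (a : ℝ≥0∞) {h : ℝ → ℝ≥0∞} (hm : Measurable h) {T : Set ℝ}
    (hT : MeasurableSet T)
    (hd : ∀ q ∈ SMax F a, dI q.1 q.2 ⊆ T ∨ Disjoint (dI q.1 q.2) T) :
    ∫⁻ x in T, good F a h x = ∫⁻ x in T, h x := by
  unfold good
  rw [lintegral_add_left (hm.indicator (meas_Om F a).compl),
    lintegral_tsum (fun q => (measurable_const.indicator (meas_dI _ _)).aemeasurable),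
    lintegral_indicator (meas_Om F a).compl, Measure.restrict_restrict (meas_Om F a).compl]
  have e : ∀ q : SMax F a, ∫⁻ x in T, (dI q.1.1 q.1.2).indicator (fun _ => av h q.1.1 q.1.2) x
      = ∫⁻ x in dI q.1.1 q.1.2 ∩ T, h x := by
    intro q
    rw [lintegral_indicator (meas_dI _ _), Measure.restrict_restrict (meas_dI _ _), setLIntegral_const]
    rcases hd q.1 q.2 with hs | hs
    · rw [inter_eq_left.2 hs, vol_dI, mul_comm, w_mul_av]
    · rw [hs.inter_eq]; simp
  simp_rw [e]
  rw [← lintegral_iUnion (fun q => (meas_dI _ _).inter hT)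
    (fun q q' hne => ((max_disj F a).subtype _ _ hne).mono inter_subset_left inter_subset_left),
    ← iUnion_inter]
  change (∫⁻ x in (Om F a)ᶜ ∩ T, h x) + (∫⁻ x in (Om F a) ∩ T, h x) = _
  rw [inter_comm, inter_comm (Om F a), add_comm, lintegral_inter_add_diff (B := Om F a) h T (meas_Om F a) |>.symm]
  rfl

lemma good_sq (F : ℝ → ℝ≥0∞) (a : ℝ≥0∞) (h : ℝ → ℝ≥0∞) (x : ℝ) :
    good F a h x ^ 2 = (Om F a)ᶜ.indicator (fun y => h y ^ 2) x +
      ∑' q : SMax F a, (dI q.1.1 q.1.2).indicator (fun _ => av h q.1.1 q.1.2 ^ 2) x := by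
  unfold good
  by_cases hx : x ∈ Om F a
  · obtain ⟨q, hq⟩ := mem_iUnion.1 hx
    have hne : ∀ q' : SMax F a, q' ≠ q → x ∉ dI q'.1.1 q'.1.2 := by
      intro q' hne hq'
      exact Set.disjoint_left.1 ((max_disj F a).subtype _ _ hne) hq' hq
    rw [tsum_eq_single q (fun q' h' => indicator_of_notMem (hne q' h') _),
      tsum_eq_single q (fun q' h' => indicator_of_notMem (hne q' h') _)]
    simp [hx, hq]
  · have hne : ∀ q' : SMax F a, x ∉ dI q'.1.1 q'.1.2 := fun q' hq' => hx (mem_iUnion.2 ⟨q', hq'⟩)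
    simp [hx, hne]

lemma good_sq_int (F : ℝ → ℝ≥0∞) (a : ℝ≥0∞) {h : ℝ → ℝ≥0∞} (hm : Measurable h) :
    ∫⁻ x, good F a h x ^ 2 = (∫⁻ x in (Om F a)ᶜ, h x ^ 2) +
      ∑' q : SMax F a, w q.1.1 * av h q.1.1 q.1.2 ^ 2 := by
  simp_rw [good_sq]
  rw [lintegral_add_left ((hm.pow_const 2).indicator (meas_Om F a).compl),
    lintegral_tsum (fun q => (measurable_const.indicator (meas_dI _ _)).aemeasurable),
    lintegral_indicator (meas_Om F a).compl]
  congr 1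
  refine tsum_congr fun q => ?_
  rw [lintegral_indicator (meas_dI _ _), setLIntegral_const, vol_dI, mul_comm]

lemma half_sq (c : ℝ≥0∞) : (c ^ (1/2:ℝ)) ^ 2 = c := by
  rw [← ENNReal.rpow_natCast, ← ENNReal.rpow_mul]; norm_num

lemma mink {N : ℕ} (μ : Measure ℝ) (h : Fin N → ℝ → ℝ≥0∞) (hm : ∀ j, Measurable (h j))
    (hf : ∀ j, ∫⁻ x, h j x ∂μ ≠ ∞) :
    ∑ j, (∫⁻ x, h j x ∂μ) ^ 2 ≤ (∫⁻ x, (∑ j, h j x ^ 2) ^ (1/2:ℝ) ∂μ) ^ 2 := by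
  set V := ∑ j, (∫⁻ x, h j x ∂μ) ^ 2 with hV
  have hVt : V ≠ ∞ := by
    rw [hV]; exact ENNReal.sum_ne_top.2 fun j _ => ENNReal.pow_ne_top (hf j)
  have hHt : V ^ (1/2:ℝ) ≠ ∞ := ENNReal.rpow_ne_top_of_nonneg (by norm_num) hVt
  by_cases hV0 : V = 0
  · rw [hV0]; exact zero_le
  have hH0 : V ^ (1/2:ℝ) ≠ 0 := by
    intro h0
    apply hV0
    rw [← half_sq V, h0]; simp
  have h1 : V ^ (1/2:ℝ) * V ^ (1/2:ℝ) ≤ V ^ (1/2:ℝ) * ∫⁻ x, (∑ j, h j x ^ 2) ^ (1/2:ℝ) ∂μ := by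
    rw [← sq, half_sq]
    calc V = ∫⁻ x, ∑ j, (∫⁻ y, h j y ∂μ) * h j x ∂μ := by
          rw [lintegral_finsetSum _ (fun j _ => (hm j).const_mul _), hV]
          refine Finset.sum_congr rfl fun j _ => ?_
          rw [lintegral_const_mul _ (hm j), sq]
      _ ≤ ∫⁻ x, V ^ (1/2:ℝ) * (∑ j, h j x ^ 2) ^ (1/2:ℝ) ∂μ := by
          refine lintegral_mono fun x => ?_
          have := ENNReal.inner_le_Lp_mul_Lq Finset.univ (fun j => ∫⁻ y, h j y ∂μ) (fun j => h j x)
            Real.HolderConjugate.two_two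
          simpa [hV] using this
      _ = _ := lintegral_const_mul' _ _ hHt
  have h2 := (ENNReal.mul_le_mul_iff_right hH0 hHt).1 h1
  rw [← half_sq V]
  gcongr

lemma sum_good {N : ℕ} (h : Fin N → ℝ → ℝ≥0∞) (hm : ∀ j, Measurable (h j)) (F : ℝ → ℝ≥0∞)
    (hF : F = fun x => (∑ j, h j x ^ 2) ^ (1/2:ℝ)) (hf : ∫⁻ x, F x ≠ ∞)
    (hhf : ∀ j, ∫⁻ x, h j x ≠ ∞) {a : ℝ≥0∞} (ha : a ≠ 0) (hat : a ≠ ∞) :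
    ∑ j, ∫⁻ x, good F a (h j) x ^ 2 ≤ 5 * a * ∫⁻ x, F x := by
  have hFm : Measurable F := by
    rw [hF]
    exact (Finset.measurable_sum _ fun j _ => (hm j).pow_const 2).pow_const _
  simp_rw [good_sq_int F a (hm _)]
  rw [Finset.sum_add_distrib, ← lintegral_finsetSum _ (fun j _ => (hm j).pow_const 2),
    ← Summable.tsum_finsetSum (fun _ _ => ENNReal.summable)]
  have h1 : ∫⁻ x in (Om F a)ᶜ, ∑ j, h j x ^ 2 ≤ a * ∫⁻ x, F x := by
    calc _ ≤ ∫⁻ x in (Om F a)ᶜ, a * F x := by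
          refine setLIntegral_mono_ae (hFm.const_mul a).aemeasurable ?_
          filter_upwards [ae_le_Om hFm hf ha] with x hx hxO
          have : ∑ j, h j x ^ 2 = F x ^ 2 := by rw [hF]; exact (half_sq _).symm
          rw [this, sq]
          gcongr
          exact hx hxO
      _ ≤ ∫⁻ x, a * F x := setLIntegral_le_lintegral _ _
      _ = _ := lintegral_const_mul _ hFm
  have h2 : ∀ q : SMax F a, ∑ j, w q.1.1 * av (h j) q.1.1 q.1.2 ^ 2 ≤ 4 * a * (a * w q.1.1) := by
    intro q
    have hM := mink (volume.restrict (dI q.1.1 q.1.2)) h hm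
      (fun j => ne_top_of_le_ne_top (hhf j) (setLIntegral_le_lintegral _ _))
    have h3 : ∑ j, av (h j) q.1.1 q.1.2 ^ 2 ≤ av F q.1.1 q.1.2 ^ 2 := by
      unfold av
      simp_rw [mul_pow]
      rw [← Finset.mul_sum]
      have e : ∫⁻ y in dI q.1.1 q.1.2, F y =
          ∫⁻ y in dI q.1.1 q.1.2, (∑ j, h j y ^ 2) ^ (1/2:ℝ) :=
        lintegral_congr fun y => congrFun hF y
      rw [e]
      gcongr
    rw [← Finset.mul_sum]
    calc _ ≤ w q.1.1 * (2 * a) ^ 2 := by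
          gcongr
          refine h3.trans ?_
          gcongr
          exact max_le q.2
      _ = _ := by ring
  calc _ ≤ a * (∫⁻ x, F x) + ∑' q : SMax F a, 4 * a * (a * w q.1.1) :=
        add_le_add h1 (ENNReal.tsum_le_tsum h2)
    _ = a * (∫⁻ x, F x) + 4 * a * (a * ∑' q : SMax F a, w q.1.1) := by
        rw [ENNReal.tsum_mul_left, ENNReal.tsum_mul_left]
    _ ≤ a * (∫⁻ x, F x) + 4 * a * ∫⁻ x, F x := by
        gcongr; exact sum_le F a
    _ = _ := by ring

lemma SM_good {n : ℤ} {F : ℝ → ℝ≥0∞} {a : ℝ≥0∞} {h : ℝ → ℝ≥0∞} (hm : Measurable h) {x : ℝ}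
    (hx : x ∉ EX n F a) : SM n h x ≤ SM n (good F a h) x := by
  unfold SM
  refine iSup_mono fun k => iSup_mono fun m => iSup_mono fun hxm => le_of_eq ?_
  have h1 := not_EX hx hxm
  unfold av
  rw [good_int F a hm (meas_dI _ _)]
  intro q hq
  by_cases hd : Disjoint (dI q.1 q.2) (dI k (m+n))
  · exact Or.inr hd
  · left
    obtain ⟨y, hy1, hy2⟩ := Set.not_disjoint_iff.1 hd
    rcases le_total q.1 k with hle | hle
    · exact dI_nest hle hy1 hy2
    · exact absurd (dI_nest hle hy2 hy1) (h1 q hq)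

lemma main {n : ℤ} {L : ℕ} (hL : |(n:ℝ)| ≤ 2^L) {N : ℕ} (h : Fin N → ℝ → ℝ≥0∞)
    (hm : ∀ j, Measurable (h j)) {a : ℝ≥0∞} (ha : a ≠ 0) (hat : a ≠ ∞) :
    a * volume {x | a < (∑ j, SM n (h j) x ^ 2) ^ (1/2:ℝ)} ≤
      41 * (L + 3) * ∫⁻ x, (∑ j, h j x ^ 2) ^ (1/2:ℝ) := by
  set F : ℝ → ℝ≥0∞ := fun x => (∑ j, h j x ^ 2) ^ (1/2:ℝ) with hF
  by_cases hf : ∫⁻ x, F x = ∞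
  · rw [hf, ENNReal.mul_top (by simp)]; exact le_top
  have hle : ∀ j x, h j x ≤ F x := by
    intro j x
    have : h j x ^ 2 ≤ F x ^ 2 := by
      rw [hF]
      simp only [half_sq]
      exact Finset.single_le_sum (f := fun j => h j x ^ 2) (fun _ _ => zero_le) (Finset.mem_univ j)
    exact (ENNReal.pow_le_pow_left_iff (by norm_num)).1 this
  have hhf : ∀ j, ∫⁻ x, h j x ≠ ∞ := fun j =>
    ne_top_of_le_ne_top hf (lintegral_mono (hle j))
  have hgf : ∀ j, ∫⁻ x, good F a (h j) x ≠ ∞ := by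
    intro j
    have := good_int F a (hm j) MeasurableSet.univ (fun q _ => Or.inl (subset_univ _))
    simp only [Measure.restrict_univ] at this
    rw [this]; exact hhf j
  set B := {x | a ^ 2 ≤ ∑ j, SM n (good F a (h j)) x ^ 2} with hB
  have hsub : {x | a < (∑ j, SM n (h j) x ^ 2) ^ (1/2:ℝ)} ⊆ EX n F a ∪ B := by
    intro x hx
    by_cases hxE : x ∈ EX n F a
    · exact Or.inl hxE
    · right
      have hx' : a < (∑ j, SM n (h j) x ^ 2) ^ (1/2:ℝ) := hx
      have h1 : a ^ 2 ≤ ∑ j, SM n (h j) x ^ 2 := by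
        rw [← half_sq (∑ j, SM n (h j) x ^ 2)]; gcongr
      refine h1.trans ?_
      gcongr with j
      exact SM_good (hm j) hxE
  have hBv : a * (a * volume B) ≤ a * (40 * (L+3) * ∫⁻ x, F x) := by
    calc _ = a ^ 2 * volume B := by ring
      _ ≤ ∫⁻ x, ∑ j, SM n (good F a (h j)) x ^ 2 :=
          mul_meas_ge_le_lintegral (Finset.measurable_sum _ fun j _ => (SM_meas n _).pow_const 2) _
      _ = ∑ j, ∫⁻ x, SM n (good F a (h j)) x ^ 2 :=
          lintegral_finsetSum _ (fun j _ => (SM_meas n _).pow_const 2)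
      _ ≤ ∑ j, 8 * (L+3) * ∫⁻ x, good F a (h j) x ^ 2 :=
          Finset.sum_le_sum fun j _ => L2 hL _ (good_meas F a (hm j)) (hgf j)
      _ = 8 * (L+3) * ∑ j, ∫⁻ x, good F a (h j) x ^ 2 := by rw [Finset.mul_sum]
      _ ≤ 8 * (L+3) * (5 * a * ∫⁻ x, F x) := by
          gcongr; exact sum_good h hm F hF hf hhf ha hat
      _ = _ := by ring
  have hBv' := (ENNReal.mul_le_mul_iff_right ha hat).1 hBv
  calc _ ≤ a * (volume (EX n F a) + volume B) := by
        gcongr; exact (measure_mono hsub).trans (measure_union_le _ _)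
    _ = a * volume (EX n F a) + a * volume B := by ring
    _ ≤ (L+3) * (∫⁻ x, F x) + 40 * (L+3) * ∫⁻ x, F x :=
        add_le_add (vol_EX hL F a) hBv'
    _ = _ := by ring

lemma exists_L (n : ℤ) : ∃ L : ℕ, |(n:ℝ)| ≤ 2^L ∧
    (L:ℝ) + 3 ≤ 20 * (Real.log (2 + |(n:ℝ)|))^2 := by
  set l := Real.log (2 + |(n:ℝ)|) with hl
  have hlog2 : 1/2 ≤ Real.log 2 := by linarith [Real.log_two_gt_d9]
  have hp : (0:ℝ) < 2 + |(n:ℝ)| := by positivity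
  have hl2 : 1/2 ≤ l := hlog2.trans (Real.log_le_log (by norm_num) (by linarith [abs_nonneg (n:ℝ)]))
  refine ⟨⌈2 * l⌉₊, ?_, ?_⟩
  · have h1 : 2 * l ≤ (⌈2*l⌉₊ : ℝ) := Nat.le_ceil _
    have h2 : 2 + |(n:ℝ)| ≤ 2 ^ ⌈2*l⌉₊ := by
      rw [← Real.log_le_log_iff hp (by positivity), Real.log_pow]
      nlinarith
    linarith
  · have := Nat.ceil_lt_add_one (show 0 ≤ 2 * l by linarith)
    nlinarith

lemma shifted_eq (n : ℤ) (f : ℝ → ℂ) (h : ℝ → ℝ≥0∞) (hh : (fun y => (‖f y‖₊ : ℝ≥0∞)) =ᵐ[volume] h)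
    (x : ℝ) : shiftedMaximal n f x = SM n h x := by
  unfold shiftedMaximal SM
  refine iSup_congr fun k => iSup_congr fun m => ?_
  have : (w k)⁻¹ * ∫⁻ y in Set.Ico ((2:ℝ)^k * (m + n)) ((2:ℝ)^k * (m + n + 1)), (‖f y‖₊ : ℝ≥0∞)
      = av h k (m+n) := by
    unfold av dI
    push_cast
    rw [lintegral_congr_ae (ae_restrict_of_ae hh)]
  rw [← this]
  rfl

end Sh

/-- Weak-type (1,1) endpoint for the vector-valued shifted maximal inequality:
`α |{(∑_j (M_n f_j)²)^{1/2} > α}| ≤ C log²⟨n⟩ ‖(∑_j |f_j|²)^{1/2}‖₁`, `C` absolute. -/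
theorem stmt14 :
    ∃ C : ℝ, 0 < C ∧ ∀ (n : ℤ) (N : ℕ) (f : Fin N → ℝ → ℂ),
      (∀ j, Integrable (f j) volume) → ∀ (α : ℝ), 0 < α →
      ENNReal.ofReal α *
          volume {x : ℝ | ENNReal.ofReal α <
            (∑ j, (shiftedMaximal n (f j) x) ^ 2) ^ (1/2 : ℝ)} ≤
        ENNReal.ofReal (C * (Real.log (2 + |(n : ℝ)|)) ^ 2) *
          ∫⁻ x : ℝ, (∑ j, ((‖f j x‖₊ : ℝ≥0∞)) ^ 2) ^ (1/2 : ℝ) := by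
  refine ⟨820, by norm_num, fun n N f hf α hα => ?_⟩
  obtain ⟨L, hL, hL2⟩ := Sh.exists_L n
  have hae : ∀ j, AEMeasurable (fun y => (‖f j y‖₊ : ℝ≥0∞)) volume := fun j =>
    (hf j).aestronglyMeasurable.enorm
  have heq : ∀ j, (fun y => (‖f j y‖₊ : ℝ≥0∞)) =ᵐ[volume] (hae j).mk _ := fun j => (hae j).ae_eq_mk
  have hM := Sh.main hL (fun j => (hae j).mk _) (fun j => (hae j).measurable_mk)
    (a := ENNReal.ofReal α) (by simpa using hα) (by simp)
  simp_rw [Sh.shifted_eq n _ _ (heq _)]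
  have hint : ∫⁻ x : ℝ, (∑ j, ((‖f j x‖₊ : ℝ≥0∞)) ^ 2) ^ (1/2 : ℝ) =
      ∫⁻ x : ℝ, (∑ j, ((hae j).mk _ x) ^ 2) ^ (1/2 : ℝ) := by
    refine lintegral_congr_ae ?_
    filter_upwards [ae_all_iff.2 heq] with x hx
    simp only [hx]
  rw [hint]
  refine hM.trans ?_
  gcongr
  have : (41 * ((L:ℝ≥0∞) + 3)) = ENNReal.ofReal (41 * ((L:ℝ) + 3)) := by
    rw [ENNReal.ofReal_mul (by norm_num), ENNReal.ofReal_add (by positivity) (by norm_num)]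
    simp
  rw [this]
  apply ENNReal.ofReal_le_ofReal
  linarith
end
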